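/- Lattice theta sum formula: fix an integer n ≥ 2, 0 < x < 1, a real r > n−1, ξ ∈ P with all [ξ_{μν}]' ≠ 0, and i ∈ {0, …, n−1}. Set l = ξ + ρ, β₀ = 1/√(r(r−1)), and let β₁ = −√((r−1)/r) < β₂ = √(r/(r−1)) be the roots of t² − β₀t − 1 = 0. Then the series Σ_{a ∈ P, a ≡ ξ + ω_i (mod Q)} x^{n⟨β₁(a+ρ)+β₂l, β₁(a+ρ)+β₂l⟩} ∏_{0≤μ<ν≤n−1} [a_{μν}] converges absolutely and equals (x^{2n}; x^{2n})_∞^{n−1} · ((x^{2n}; x^{2n})_∞/(x²; x²)_∞) · ((x^{2r}; x^{2r})_∞/(x^{2r−2}; x^{2r−2})_∞)^{(n−1)(n−2)/2} · ∏_{0≤μ<ν≤n−1} [ξ_{μν}]'. -/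

import Mathlib

noncomputable section

/-- The q-Pochhammer infinite product `(z; q)_∞ = ∏_{k ≥ 0} (1 - z q^k)` (real form). -/
def qPochR (z q : ℝ) : ℝ := ∏' k : ℕ, (1 - z * q ^ k)

/-- `Θ_q(z) = (z;q)_∞ (q z⁻¹;q)_∞ (q;q)_∞` (real form). -/
def thetaR (q z : ℝ) : ℝ := qPochR z q * qPochR (q * z⁻¹) q * qPochR q q

/-- The elliptic symbol `[v] = x^(v²/r - v) Θ_{x^{2r}}(x^{2v})` (real form). -/
def ebrkR (x r v : ℝ) : ℝ := x ^ (v ^ 2 / r - v) * thetaR (x ^ (2 * r)) (x ^ (2 * v))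

/-- The primed elliptic symbol `[v]' = x^(v²/(r-1) - v) Θ_{x^{2r-2}}(x^{2v})`. -/
def ebrkR' (x r v : ℝ) : ℝ :=
  x ^ (v ^ 2 / (r - 1) - v) * thetaR (x ^ (2 * r - 2)) (x ^ (2 * v))

/-- `ε̄_μ = ε_μ - (1/n) Σ_ν ε_ν`, as a vector in `ℝⁿ`. -/
def ebar (n : ℕ) (μ : Fin n) : Fin n → ℝ := fun j => (if j = μ then 1 else 0) - 1 / n

/-- The weight lattice `P = ⊕_μ ℤ ε̄_μ` of `A^{(1)}_{n-1}`, as a subset of `ℝⁿ`. -/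
def PLat (n : ℕ) : Set (Fin n → ℝ) :=
  {v | ∃ c : Fin n → ℤ, v = ∑ μ, (c μ : ℝ) • ebar n μ}

/-- The root lattice `Q = ⊕_{μ=1}^{n-1} ℤ α_μ` of `A^{(1)}_{n-1}`: the integer vectors
in `ℝⁿ` whose coordinates sum to zero. -/
def QLat (n : ℕ) : Set (Fin n → ℝ) :=
  {v | (∀ j, ∃ m : ℤ, v j = m) ∧ ∑ j, v j = 0}

/-- The fundamental weight `ω_m = ε̄_0 + ⋯ + ε̄_{m-1}` (with `ω_0 = 0`). -/
def omegaw (n m : ℕ) : Fin n → ℝ :=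
  ∑ ν ∈ Finset.univ.filter (fun ν : Fin n => (ν : ℕ) < m), ebar n ν

/-- `ρ = ω_1 + ⋯ + ω_{n-1}`. -/
def rhoWt (n : ℕ) : Fin n → ℝ := ∑ m ∈ Finset.Icc 1 (n - 1), omegaw n m

/-- `ā_μ = ⟨a + ρ, ε_μ⟩`. -/
def abar (n : ℕ) (a : Fin n → ℝ) (μ : Fin n) : ℝ := a μ + rhoWt n μ


section AuxJTP

set_option linter.unusedSectionVars false

open Filter Topology

lemma summable_gauss (a c : ℝ) (ha : 0 < a) :
    Summable fun k : ℤ => Real.exp (-a * (k : ℝ) ^ 2 + c * k) := by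
  have h1 : Summable fun k : ℤ => Real.exp (-|(k : ℝ)|) := by
    apply Summable.of_nat_of_neg
    · simpa using Real.summable_exp_neg_nat
    · simpa using Real.summable_exp_neg_nat
  refine Summable.of_nonneg_of_le (fun k => (Real.exp_pos _).le) (fun k => ?_)
    (h1.mul_left (Real.exp ((|c| + 1) ^ 2 / (4 * a))))
  rw [← Real.exp_add]
  apply Real.exp_le_exp.mpr
  have h2 : c * k ≤ |c| * |(k : ℝ)| := by
    rw [← abs_mul]; exact le_abs_self _
  have h3 : (k : ℝ) ^ 2 = |(k : ℝ)| ^ 2 := (sq_abs _).symm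
  rw [h3]
  set t := |(k : ℝ)|
  have h4 : (|c| + 1) ^ 2 / (4 * a) - (|c| + 1) * t + a * t ^ 2
      = (2 * a * t - (|c| + 1)) ^ 2 / (4 * a) := by
    field_simp; ring
  have h5 : 0 ≤ (2 * a * t - (|c| + 1)) ^ 2 / (4 * a) := by positivity
  linarith

/-- Generic q-Pochhammer. -/
def qP {𝕜 : Type*} [NormedField 𝕜] (z q : 𝕜) : 𝕜 := ∏' k : ℕ, (1 - z * q ^ k)

variable {𝕜 : Type*} [NormedField 𝕜]

/-- finite q-Pochhammer -/
def qPf (z q : 𝕜) (N : ℕ) : 𝕜 := ∏ k ∈ Finset.range N, (1 - z * q ^ k)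

lemma qP_summable (z q : 𝕜) (hq : ‖q‖ < 1) : Summable fun k : ℕ => ‖-(z * q ^ k)‖ := by
  simp only [norm_neg, norm_mul, norm_pow]
  exact (summable_geometric_of_lt_one (norm_nonneg _) hq).mul_left _

variable [CompleteSpace 𝕜]

lemma qP_multipliable (z q : 𝕜) (hq : ‖q‖ < 1) :
    Multipliable fun k : ℕ => (1 - z * q ^ k) := by
  have := multipliable_one_add_of_summable (qP_summable z q hq)
  simpa [sub_eq_add_neg] using this

lemma qP_tendsto (z q : 𝕜) (hq : ‖q‖ < 1) :
    Tendsto (qPf z q) atTop (𝓝 (qP z q)) :=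
  (qP_multipliable z q hq).tendsto_prod_tprod_nat

lemma qP_ne_zero (z q : 𝕜) (hq : ‖q‖ < 1) (h : ∀ k : ℕ, z * q ^ k ≠ 1) : qP z q ≠ 0 := by
  have := tprod_one_add_ne_zero_of_summable (f := fun k : ℕ => -(z * q ^ k))
    (fun k => by rw [← sub_eq_add_neg, sub_ne_zero]; exact (h k).symm) (qP_summable z q hq)
  simpa [sub_eq_add_neg, qP] using this

lemma pow_succ_ne_one' (q : 𝕜) (hq : ‖q‖ < 1) (k : ℕ) : q * q ^ k ≠ 1 := by
  intro h
  have h2 : ‖q * q ^ k‖ < 1 := by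
    rw [← pow_succ', norm_pow]
    exact pow_lt_one₀ (norm_nonneg _) hq (by omega)
  rw [h] at h2
  simp at h2

lemma qPqq_ne_zero (q : 𝕜) (hq : ‖q‖ < 1) : qP q q ≠ 0 :=
  qP_ne_zero q q hq (pow_succ_ne_one' q hq)

lemma qPf_ne_zero (q : 𝕜) (hq : ‖q‖ < 1) (N : ℕ) : qPf q q N ≠ 0 :=
  Finset.prod_ne_zero_iff.mpr fun k _ => sub_ne_zero.mpr (pow_succ_ne_one' q hq k).symm

/-- reciprocal finite Pochhammer extended by zero -/
def gRec (q : 𝕜) (m : ℤ) : 𝕜 := if 0 ≤ m then (qPf q q m.toNat)⁻¹ else 0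

lemma gRec_pred (q : 𝕜) (hq0 : q ≠ 0) (hq : ‖q‖ < 1) (m : ℤ) :
    gRec q (m - 1) = (1 - q ^ m) * gRec q m := by
  unfold gRec
  rcases lt_trichotomy m 0 with h | h | h
  · rw [if_neg (by omega), if_neg (by omega)]; simp
  · subst h; simp
  · rw [if_pos (by omega), if_pos (by omega)]
    obtain ⟨k, rfl⟩ : ∃ k : ℕ, m = k + 1 := ⟨(m - 1).toNat, by omega⟩
    have e1 : ((k : ℤ) + 1 - 1).toNat = k := by omega
    have e2 : ((k : ℤ) + 1).toNat = k + 1 := by omega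
    rw [e1, e2]
    have h1 := qPf_ne_zero q hq k
    have h2 := qPf_ne_zero q hq (k + 1)
    have h3 : qPf q q (k + 1) = qPf q q k * (1 - q ^ ((k : ℤ) + 1)) := by
      unfold qPf
      rw [Finset.prod_range_succ, zpow_add_one₀ hq0, zpow_natCast, mul_comm q]
    have h4 : (1 - q ^ ((k : ℤ) + 1)) ≠ 0 := by
      intro h; rw [h3, h] at h2; simp at h2
    rw [h3]; field_simp

/-- triangular exponent -/
def tri (k : ℤ) : ℤ := k * (k - 1) / 2

lemma two_tri (k : ℤ) : 2 * tri k = k * (k - 1) := by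
  unfold tri
  have : (2 : ℤ) ∣ k * (k - 1) := by
    have := Int.even_mul_pred_self k
    exact this.two_dvd
  omega

lemma tri_pred (k : ℤ) : tri (k - 1) = tri k - (k - 1) := by
  have h1 := two_tri k
  have h2 := two_tri (k - 1)
  nlinarith

lemma tri_succ (k : ℤ) : tri (k + 1) = tri k + k := by
  have h1 := two_tri k
  have h2 := two_tri (k + 1)
  nlinarith

/-- finite Jacobi coefficients -/
def jA (q : 𝕜) (N : ℕ) (k : ℤ) : 𝕜 :=
  (-1) ^ k * q ^ tri k * (qPf q q (2 * N) * gRec q (N - k) * gRec q (N + k))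

lemma jA_rec (q : 𝕜) (hq0 : q ≠ 0) (hq : ‖q‖ < 1) (N : ℕ) (k : ℤ) :
    jA q (N + 1) k = (1 + q ^ (2 * N + 1)) * jA q N k - q ^ N * jA q N (k - 1)
      - q ^ (N + 1) * jA q N (k + 1) := by
  unfold jA
  have hneg : (-1 : 𝕜) ≠ 0 := by simp
  set a : ℤ := N + 1 - k with ha
  set b : ℤ := N + 1 + k with hb
  have e1 : ((N : ℤ) - k) = a - 1 := by omega
  have e2 : ((N : ℤ) + k) = b - 1 := by omega
  have e3 : ((N : ℤ) - (k - 1)) = a := by omega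
  have e4 : ((N : ℤ) + (k - 1)) = b - 1 - 1 := by omega
  have e5 : ((N : ℤ) - (k + 1)) = a - 1 - 1 := by omega
  have e6 : ((N : ℤ) + (k + 1)) = b := by omega
  have e7 : ((N + 1 : ℕ) : ℤ) - k = a := by push_cast; omega
  have e8 : ((N + 1 : ℕ) : ℤ) + k = b := by push_cast; omega
  rw [e1, e2, e3, e4, e5, e6, e7, e8]
  simp only [gRec_pred q hq0 hq]
  rw [tri_pred, tri_succ]
  have p1 : qPf q q (2 * (N + 1)) = qPf q q (2 * N) * (1 - q ^ (2 * N + 1)) * (1 - q ^ (2 * N + 2)) := by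
    unfold qPf
    rw [show 2 * (N + 1) = 2 * N + 1 + 1 by ring, Finset.prod_range_succ, Finset.prod_range_succ]
    ring
  rw [p1]
  have hX : q ^ a ≠ 0 := zpow_ne_zero _ hq0
  have hk : q ^ b = q ^ (2 * N + 2) / q ^ a := by
    rw [eq_div_iff hX, ← zpow_add₀ hq0, ← zpow_natCast]; congr 1; push_cast; omega
  have hk2 : q ^ k = q ^ (N + 1) / q ^ a := by
    rw [eq_div_iff hX, ← zpow_add₀ hq0, ← zpow_natCast]; congr 1; push_cast; omega
  rw [zpow_sub₀ hneg k, zpow_add₀ hneg k, zpow_sub₀ hq0 (tri k), zpow_sub₀ hq0 k,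
    zpow_add₀ hq0 (tri k), zpow_sub₀ hq0 b, zpow_sub₀ hq0 a]
  rw [hk, hk2]
  simp only [zpow_one]
  field_simp
  ring

lemma jA_zero (q : 𝕜) (k : ℤ) (hk : k ≠ 0) : jA q 0 k = 0 := by
  unfold jA gRec
  rcases lt_or_gt_of_ne hk with h | h
  · rw [if_neg (c := 0 ≤ ((0 : ℕ) : ℤ) + k) (by push_cast; omega)]; simp
  · rw [if_neg (c := 0 ≤ ((0 : ℕ) : ℤ) - k) (by push_cast; omega)]; simp

lemma finite_jtp (q z : 𝕜) (hq0 : q ≠ 0) (hq : ‖q‖ < 1) (hz : z ≠ 0) (N : ℕ) :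
    HasSum (fun k : ℤ => jA q N k * z ^ k) (qPf z q N * qPf (q * z⁻¹) q N) := by
  induction N with
  | zero =>
    have : qPf z q 0 * qPf (q * z⁻¹) q 0 = jA q 0 0 * z ^ (0 : ℤ) := by
      simp [qPf, jA, gRec, tri]
    rw [this]
    apply hasSum_single
    intro k hk
    rw [jA_zero q k hk, zero_mul]
  | succ N ih =>
    have h1 : HasSum (fun k : ℤ => jA q N (k - 1) * z ^ k) (z * (qPf z q N * qPf (q * z⁻¹) q N)) := by
      have := ((Equiv.subRight (1 : ℤ)).hasSum_iff.mpr ih).mul_left z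
      refine this.congr_fun ?_
      intro k
      simp only [Function.comp, Equiv.subRight_apply]
      rw [zpow_sub_one₀ hz]; field_simp
    have h2 : HasSum (fun k : ℤ => jA q N (k + 1) * z ^ k) (z⁻¹ * (qPf z q N * qPf (q * z⁻¹) q N)) := by
      have := ((Equiv.addRight (1 : ℤ)).hasSum_iff.mpr ih).mul_left z⁻¹
      refine this.congr_fun ?_
      intro k
      simp only [Function.comp, Equiv.coe_addRight]
      rw [zpow_add_one₀ hz]; field_simp
    have h3 := ((ih.mul_left (1 + q ^ (2 * N + 1))).sub (h1.mul_left (q ^ N))).sub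
      (h2.mul_left (q ^ (N + 1)))
    convert! h3 using 1
    · ext k; rw [jA_rec q hq0 hq]; ring
    · unfold qPf
      rw [Finset.prod_range_succ, Finset.prod_range_succ]
      field_simp
      ring

lemma norm_tri_summable (q z : 𝕜) (hq0 : q ≠ 0) (hq : ‖q‖ < 1) (hz : z ≠ 0) :
    Summable fun k : ℤ => ‖(-1) ^ k * q ^ tri k * z ^ k‖ := by
  have hqp : 0 < ‖q‖ := norm_pos_iff.mpr hq0
  have hzp : 0 < ‖z‖ := norm_pos_iff.mpr hz
  have := summable_gauss (-Real.log ‖q‖ / 2) (-Real.log ‖q‖ / 2 + Real.log ‖z‖)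
    (by have := Real.log_neg hqp hq; linarith)
  refine this.congr ?_
  intro k
  simp only [norm_mul, norm_zpow, norm_neg, norm_one, one_zpow, one_mul]
  rw [← Real.rpow_intCast, ← Real.rpow_intCast, Real.rpow_def_of_pos hqp, Real.rpow_def_of_pos hzp,
    ← Real.exp_add]
  congr 1
  have h2 : (2 : ℝ) * (tri k : ℝ) = k * (k - 1) := by exact_mod_cast two_tri k
  have h3 : (tri k : ℝ) = k * (k - 1) / 2 := by linarith
  rw [h3]; ring

lemma gRec_tendsto (q : 𝕜) (hq : ‖q‖ < 1) (f : ℕ → ℤ) (hf : Tendsto f atTop atTop) :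
    Tendsto (fun N => gRec q (f N)) atTop (𝓝 (qP q q)⁻¹) := by
  have h1 : Tendsto (fun N => (qPf q q (f N).toNat)⁻¹) atTop (𝓝 (qP q q)⁻¹) := by
    refine Tendsto.inv₀ ((qP_tendsto q q hq).comp ?_) (qPqq_ne_zero q hq)
    refine tendsto_atTop_atTop.mpr fun b => ?_
    obtain ⟨i, hi⟩ := tendsto_atTop_atTop.mp hf b
    exact ⟨i, fun a ha => by have := hi a ha; omega⟩
  refine h1.congr' ?_
  filter_upwards [hf.eventually_ge_atTop 0] with N hN
  unfold gRec; rw [if_pos hN]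

lemma bdd_of_tendsto {f : ℕ → 𝕜} {a : 𝕜} (h : Tendsto f atTop (𝓝 a)) : ∃ C, 0 ≤ C ∧ ∀ n, ‖f n‖ ≤ C := by
  obtain ⟨C, hC⟩ := h.norm.bddAbove_range
  exact ⟨C, (norm_nonneg _).trans (hC ⟨0, rfl⟩), fun n => hC ⟨n, rfl⟩⟩

theorem jacobi_triple (q z : 𝕜) (hq0 : q ≠ 0) (hq : ‖q‖ < 1) (hz : z ≠ 0) :
    HasSum (fun k : ℤ => (-1) ^ k * q ^ tri k * z ^ k) (qP z q * qP (q * z⁻¹) q * qP q q) := by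
  have hs := norm_tri_summable q z hq0 hq hz
  have hne := qPqq_ne_zero q hq
  obtain ⟨C1, hC10, hC1⟩ := bdd_of_tendsto (qP_tendsto q q hq)
  obtain ⟨C2, hC20, hC2⟩ := bdd_of_tendsto ((qP_tendsto q q hq).inv₀ hne)
  have hg : ∀ m, ‖gRec q m‖ ≤ C2 := by
    intro m; unfold gRec; split_ifs
    · exact hC2 _
    · simpa using hC20
  have key : Tendsto (fun N : ℕ => ∑' k : ℤ, jA q N k * z ^ k) atTop
      (𝓝 (∑' k : ℤ, (-1) ^ k * q ^ tri k * z ^ k * (qP q q)⁻¹)) := by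
    apply tendsto_tsum_of_dominated_convergence (hs.mul_right (C1 * C2 * C2))
    · intro k
      have t1 : Tendsto (fun N : ℕ => qPf q q (2 * N)) atTop (𝓝 (qP q q)) :=
        (qP_tendsto q q hq).comp (tendsto_id.const_mul_atTop' (by norm_num))
      have t2 : Tendsto (fun N : ℕ => gRec q (N - k)) atTop (𝓝 (qP q q)⁻¹) :=
        gRec_tendsto q hq _ (tendsto_atTop_add_const_right _ _ tendsto_natCast_atTop_atTop)
      have t3 : Tendsto (fun N : ℕ => gRec q (N + k)) atTop (𝓝 (qP q q)⁻¹) :=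
        gRec_tendsto q hq _ (tendsto_atTop_add_const_right _ _ tendsto_natCast_atTop_atTop)
      have t4 := (((t1.mul t2).mul t3).const_mul ((-1) ^ k * q ^ tri k)).mul_const (z ^ k)
      convert! t4 using 2
      field_simp
    · refine Eventually.of_forall fun N k => ?_
      unfold jA
      rw [show (-1) ^ k * q ^ tri k * (qPf q q (2 * N) * gRec q (↑N - k) * gRec q (↑N + k)) * z ^ k
        = ((-1) ^ k * q ^ tri k * z ^ k) * (qPf q q (2 * N) * gRec q (↑N - k) * gRec q (↑N + k)) by ring]
      rw [norm_mul]
      apply mul_le_mul_of_nonneg_left _ (norm_nonneg _)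
      rw [norm_mul, norm_mul]
      exact mul_le_mul (mul_le_mul (hC1 _) (hg _) (norm_nonneg _) hC10) (hg _) (norm_nonneg _)
        (mul_nonneg hC10 hC20)
  have key2 : Tendsto (fun N : ℕ => ∑' k : ℤ, jA q N k * z ^ k) atTop
      (𝓝 (qP z q * qP (q * z⁻¹) q)) := by
    refine ((qP_tendsto z q hq).mul (qP_tendsto (q * z⁻¹) q hq)).congr fun N => ?_
    exact (finite_jtp q z hq0 hq hz N).tsum_eq.symm
  have h := tendsto_nhds_unique key key2
  rw [tsum_mul_right] at h
  have h2 : qP z q * qP (q * z⁻¹) q * qP q q = ∑' k : ℤ, (-1) ^ k * q ^ tri k * z ^ k := by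
    rw [← h]; field_simp
  rw [h2]
  exact hs.of_norm.hasSum

end AuxJTP

section AuxProd

open Filter Topology

lemma fin_prod_hasSum {𝕜 : Type*} [NormedField 𝕜] [CompleteSpace 𝕜] (β : Type*) (n : ℕ)
    (f : Fin n → β → 𝕜)
    (hf : ∀ i, Summable fun k => ‖f i k‖) :
    (Summable fun k : Fin n → β => ‖∏ i, f i (k i)‖) ∧
      HasSum (fun k : Fin n → β => ∏ i, f i (k i)) (∏ i, ∑' k, f i k) := by
  induction n with
  | zero =>
    refine ⟨Summable.of_finite, ?_⟩
    simp only [Finset.univ_eq_empty, Finset.prod_empty]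
    exact hasSum_unique (fun _ : Fin 0 → β => (1 : 𝕜))
  | succ n ih =>
    obtain ⟨h1, h2⟩ := ih (fun i => f i.succ) (fun i => hf i.succ)
    have h3 := (hf 0).mul_norm h1
    have e := Fin.consEquiv (fun _ : Fin (n + 1) => β)
    have h4 : Summable fun k : Fin (n + 1) → β => ‖∏ i, f i (k i)‖ := by
      rw [← (Fin.consEquiv (fun _ : Fin (n + 1) => β)).summable_iff]
      refine h3.congr fun p => ?_
      simp [Fin.prod_univ_succ, Fin.consEquiv]
    refine ⟨h4, ?_⟩
    have h5 := tsum_mul_tsum_of_summable_norm (hf 0) h1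
    rw [h2.tsum_eq] at h5
    rw [Fin.prod_univ_succ, h5]
    rw [← (Fin.consEquiv (fun _ : Fin (n + 1) => β)).hasSum_iff]
    convert! h3.of_norm.hasSum using 1
    ext p
    simp [Fin.prod_univ_succ, Fin.consEquiv]

lemma pi_prod_hasSum {𝕜 : Type*} [NormedField 𝕜] [CompleteSpace 𝕜] (β : Type*)
    (ι : Type*) [Fintype ι] (f : ι → β → 𝕜)
    (hf : ∀ i, Summable fun k => ‖f i k‖) :
    (Summable fun k : ι → β => ‖∏ i, f i (k i)‖) ∧
      HasSum (fun k : ι → β => ∏ i, f i (k i)) (∏ i, ∑' k, f i k) := by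
  let e := Fintype.equivFin ι
  obtain ⟨h1, h2⟩ := fin_prod_hasSum β (Fintype.card ι) (fun i => f (e.symm i)) (fun i => hf _)
  let E : (ι → β) ≃ (Fin (Fintype.card ι) → β) := e.arrowCongr (Equiv.refl β)
  have hE : ∀ k : ι → β, ∏ i, f (e.symm i) (E k i) = ∏ i, f i (k i) := by
    intro k
    rw [← e.symm.prod_comp]
    simp [E]
  constructor
  · rw [← E.summable_iff] at h1
    exact h1.congr fun k => by simp only [Function.comp]; rw [hE]
  · rw [← E.hasSum_iff] at h2
    rw [← e.symm.prod_comp]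
    exact h2.congr_fun fun k => (by simp only [Function.comp]; rw [hE])

@[to_additive]
lemma prod_pairs {M : Type*} [CommMonoid M] (n : ℕ) (f : Fin n → Fin n → M) :
    ∏ p ∈ Finset.univ.filter (fun p : Fin n × Fin n => p.1 < p.2), (f p.1 p.2 * f p.2 p.1)
      = ∏ i, ∏ j, if i = j then 1 else f i j := by
  have h1 : ∏ i, ∏ j, (if i = j then 1 else f i j)
      = ∏ p : Fin n × Fin n, (if p.1 < p.2 then f p.1 p.2 else 1)
        * (if p.2 < p.1 then f p.1 p.2 else 1) := by
    rw [← Finset.univ_product_univ, Finset.prod_product]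
    refine Finset.prod_congr rfl fun i _ => Finset.prod_congr rfl fun j _ => ?_
    rcases lt_trichotomy i j with h | h | h
    · simp [h, h.ne, h.not_gt]
    · simp [h]
    · simp [h, h.ne', h.not_gt]
  rw [h1, Finset.prod_mul_distrib, Finset.prod_mul_distrib]
  congr 1
  · rw [Finset.prod_filter]
  · rw [Finset.prod_filter, ← (Equiv.prodComm (Fin n) (Fin n)).prod_comp]
    rfl

@[to_additive]
lemma prod_pairs_snd {M : Type*} [CommMonoid M] (n : ℕ) (g : Fin n → M) :
    ∏ p ∈ Finset.univ.filter (fun p : Fin n × Fin n => p.1 < p.2), g p.2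
      = ∏ j, g j ^ (j : ℕ) := by
  rw [Finset.prod_filter, ← Finset.univ_product_univ, Finset.prod_product_right]
  refine Finset.prod_congr rfl fun j _ => ?_
  rw [← Finset.prod_filter]
  simp only
  rw [Finset.prod_const]
  congr 1
  have : Finset.univ.filter (fun i : Fin n => i < j) = Finset.Iio j := by ext; simp
  rw [this]; simp

lemma prod_pairs_Ioi {M : Type*} [CommMonoid M] (n : ℕ) (f : Fin n → Fin n → M) :
    ∏ p ∈ Finset.univ.filter (fun p : Fin n × Fin n => p.1 < p.2), f p.1 p.2
      = ∏ i, ∏ j ∈ Finset.Ioi i, f i j := by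
  rw [Finset.prod_filter, ← Finset.univ_product_univ, Finset.prod_product]
  refine Finset.prod_congr rfl fun i _ => ?_
  rw [← Finset.prod_filter]
  congr 1
  ext; simp

end AuxProd

section AuxTour

/-- integer tournaments -/
abbrev Tour (n : ℕ) : Type :=
  {K : Fin n → Fin n → ℤ // (∀ i, K i i = 0) ∧ ∀ i j, i ≠ j → K i j + K j i = 1}

/-- edges -/
abbrev PEdge (n : ℕ) : Type := {p : Fin n × Fin n // p.1 < p.2}

/-- a tournament is determined by its upper triangle -/
def tourEquiv (n : ℕ) : (PEdge n → ℤ) ≃ Tour n where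
  toFun k := ⟨fun i j => if h : i < j then k ⟨(i, j), h⟩ else if h : j < i then 1 - k ⟨(j, i), h⟩
    else 0, by
      constructor
      · intro i; simp
      · intro i j hij
        rcases lt_or_gt_of_ne hij with h | h
        · simp [h, h.not_gt]
        · simp [h, h.not_gt]⟩
  invFun K := fun e => K.1 e.1.1 e.1.2
  left_inv k := by
    funext e
    obtain ⟨⟨i, j⟩, h⟩ := e
    have h' : i < j := h
    simp [h']
  right_inv K := by
    apply Subtype.ext
    funext i j
    simp only
    split_ifs with h1 h2
    · rfl
    · have := K.2.2 i j h2.ne'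
      omega
    · have : i = j := le_antisymm (not_lt.mp h2) (not_lt.mp h1)
      subst this
      exact (K.2.1 i).symm

/-- the set of pairs -/
abbrev prs (n : ℕ) : Finset (Fin n × Fin n) :=
  Finset.univ.filter (fun p : Fin n × Fin n => p.1 < p.2)

lemma prod_edge {M : Type*} [CommMonoid M] (n : ℕ) (f : Fin n × Fin n → M) :
    ∏ e : PEdge n, f e.1 = ∏ p ∈ prs n, f p := by
  symm
  exact Finset.prod_subtype _ (by intro p; simp) f

/-- sign of a tournament -/
def sgnK {n : ℕ} (K : Tour n) : ℝ := ∏ p ∈ prs n, (-1 : ℝ) ^ (K.1 p.1 p.2)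

/-- energy of a tournament -/
def enK {n : ℕ} (K : Tour n) : ℤ := ∑ p ∈ prs n, tri (K.1 p.1 p.2)

/-- score -/
def scK {n : ℕ} (K : Tour n) : Fin n → ℤ := fun i => ∑ j, K.1 i j

/-- weight -/
def wtK {n : ℕ} (q : ℝ) (K : Tour n) : ℝ := sgnK K * q ^ enK K

lemma tri_zero : tri 0 = 0 := by simp [tri]

lemma tri_symm {n : ℕ} (K : Tour n) (i j : Fin n) : tri (K.1 i j) = tri (K.1 j i) := by
  by_cases h : i = j
  · subst h; rfl
  · have := K.2.2 i j h
    have h1 : K.1 j i = 1 - K.1 i j := by omega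
    have h2 := two_tri (K.1 i j)
    have h3 := two_tri (K.1 j i)
    rw [h1] at h3 ⊢
    nlinarith

lemma two_enK {n : ℕ} (K : Tour n) : 2 * enK K = ∑ i, ∑ j, tri (K.1 i j) := by
  have h := sum_pairs n (fun i j => tri (K.1 i j))
  have h2 : ∑ i, ∑ j, (if i = j then 0 else tri (K.1 i j)) = ∑ i, ∑ j, tri (K.1 i j) := by
    refine Finset.sum_congr rfl fun i _ => Finset.sum_congr rfl fun j _ => ?_
    split_ifs with hij
    · subst hij; rw [K.2.1 i, tri_zero]
    · rfl
  rw [← h2, ← h, enK, Finset.mul_sum]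
  refine Finset.sum_congr rfl fun p _ => ?_
  rw [tri_symm K p.2 p.1]; ring

lemma prod_z_score {𝕜 : Type*} [NormedField 𝕜] {n : ℕ} (K : Tour n) (z : Fin n → 𝕜)
    (hz : ∀ i, z i ≠ 0) :
    ∏ p ∈ prs n, (z p.1 / z p.2) ^ K.1 p.1 p.2 = ∏ i, z i ^ (scK K i - (i : ℕ)) := by
  have h1 : ∀ p ∈ prs n, (z p.1 / z p.2) ^ K.1 p.1 p.2
      = (z p.1 ^ K.1 p.1 p.2 * z p.2 ^ K.1 p.2 p.1) * (z p.2)⁻¹ := by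
    intro p hp
    have hlt : p.1 < p.2 := by simpa using hp
    have := K.2.2 p.1 p.2 hlt.ne
    have h2 : K.1 p.2 p.1 = 1 - K.1 p.1 p.2 := by omega
    rw [h2, zpow_sub₀ (hz _), div_zpow, zpow_one]
    have := hz p.2
    have h5 : z p.2 ^ K.1 p.1 p.2 ≠ 0 := zpow_ne_zero _ this
    field_simp
  rw [Finset.prod_congr rfl h1, Finset.prod_mul_distrib,
    prod_pairs n (fun i j => z i ^ K.1 i j), prod_pairs_snd n (fun j => (z j)⁻¹),
    ← Finset.prod_mul_distrib]
  refine Finset.prod_congr rfl fun i _ => ?_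
  rw [zpow_sub₀ (hz i), div_eq_mul_inv, zpow_natCast, inv_pow]
  congr 1
  have h3 : ∀ j, (if i = j then 1 else z i ^ K.1 i j) = z i ^ K.1 i j := by
    intro j
    split_ifs with hij
    · subst hij; rw [K.2.1 i, zpow_zero]
    · rfl
  simp only [h3]
  unfold scK
  induction (Finset.univ : Finset (Fin n)) using Finset.induction_on with
  | empty => simp
  | insert a s ha ih => rw [Finset.prod_insert ha, Finset.sum_insert ha, zpow_add₀ (hz i), ih]

/-- generic theta -/
def thP {𝕜 : Type*} [NormedField 𝕜] (q z : 𝕜) : 𝕜 := qP z q * qP (q * z⁻¹) q * qP q q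

lemma tour_hasSum {𝕜 : Type*} [RCLike 𝕜] {n : ℕ} (q : ℝ) (hq0 : 0 < q) (hq1 : q < 1)
    (z : Fin n → 𝕜) (hz : ∀ i, z i ≠ 0) :
    HasSum (fun K : Tour n => (wtK q K : 𝕜) * ∏ i, z i ^ (scK K i - (i : ℕ)))
      (∏ p ∈ prs n, thP (q : 𝕜) (z p.1 / z p.2)) := by
  have hq : ‖(q : 𝕜)‖ < 1 := by
    rw [RCLike.norm_ofReal, abs_of_pos hq0]; exact hq1
  have hq0' : (q : 𝕜) ≠ 0 := by exact_mod_cast hq0.ne'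
  have hd : ∀ e : PEdge n, z e.1.1 / z e.1.2 ≠ 0 := fun e => div_ne_zero (hz _) (hz _)
  have h := (pi_prod_hasSum ℤ (PEdge n)
    (fun e k => (-1) ^ k * (q : 𝕜) ^ tri k * (z e.1.1 / z e.1.2) ^ k)
    (fun e => norm_tri_summable (q : 𝕜) _ hq0' hq (hd e))).2
  have h2 : ∀ e : PEdge n, ∑' k : ℤ, (-1) ^ k * (q : 𝕜) ^ tri k * (z e.1.1 / z e.1.2) ^ k
      = thP (q : 𝕜) (z e.1.1 / z e.1.2) := fun e =>
    (jacobi_triple (q : 𝕜) _ hq0' hq (hd e)).tsum_eq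
  simp only [h2] at h
  rw [prod_edge n (fun p => thP (q : 𝕜) (z p.1 / z p.2))] at h
  rw [← (tourEquiv n).symm.hasSum_iff] at h
  refine h.congr_fun fun K => ?_
  simp only [Function.comp]
  have h3 : ∀ e : PEdge n, (tourEquiv n).symm K e = K.1 e.1.1 e.1.2 := fun e => rfl
  simp only [h3]
  rw [prod_edge n (fun p => (-1) ^ (K.1 p.1 p.2) * (q : 𝕜) ^ tri (K.1 p.1 p.2)
    * (z p.1 / z p.2) ^ (K.1 p.1 p.2))]
  rw [Finset.prod_mul_distrib, prod_z_score K z hz, Finset.prod_mul_distrib]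
  congr 1
  unfold wtK sgnK enK
  have h4 : ∏ p ∈ prs n, (q : 𝕜) ^ tri (K.1 p.1 p.2) = (q : 𝕜) ^ ∑ p ∈ prs n, tri (K.1 p.1 p.2) := by
    induction (prs n) using Finset.induction_on with
    | empty => simp
    | insert a s ha ih => rw [Finset.prod_insert ha, Finset.sum_insert ha, zpow_add₀ hq0', ih]
  rw [h4]
  push_cast
  rfl

end AuxTour

section AuxSym

/-- coefficient -/
def ccK {n : ℕ} (q : ℝ) (m : Fin n → ℤ) : ℝ :=
  ∑' K : Tour n, if scK K = m then wtK q K else 0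

lemma macd1 {𝕜 : Type*} [RCLike 𝕜] {n : ℕ} (q : ℝ) (hq0 : 0 < q) (hq1 : q < 1)
    (z : Fin n → 𝕜) (hz : ∀ i, z i ≠ 0) :
    HasSum (fun m : Fin n → ℤ => (ccK q m : 𝕜) * ∏ i, z i ^ (m i - (i : ℕ)))
      (∏ p ∈ prs n, thP (q : 𝕜) (z p.1 / z p.2)) := by
  have h := (tour_hasSum q hq0 hq1 z hz).tsum_fiberwise scK
  refine h.congr_fun fun m => ?_
  rw [tsum_subtype (scK ⁻¹' {m}) (fun K : Tour n => (wtK q K : 𝕜) * ∏ i, z i ^ (scK K i - (i : ℕ)))]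
  unfold ccK
  rw [RCLike.ofReal_tsum, ← tsum_mul_right]
  congr 1
  ext K
  by_cases hK : scK K = m
  · subst hK; simp [Set.indicator]
  · simp [Set.indicator, hK]

/-- permuting a tournament -/
def tourPerm {n : ℕ} (σ : Equiv.Perm (Fin n)) : Tour n ≃ Tour n where
  toFun K := ⟨fun i j => K.1 (σ i) (σ j), fun i => K.2.1 _, fun i j hij =>
    K.2.2 _ _ (fun h => hij (σ.injective h))⟩
  invFun K := ⟨fun i j => K.1 (σ.symm i) (σ.symm j), fun i => K.2.1 _, fun i j hij =>
    K.2.2 _ _ (fun h => hij (σ.symm.injective h))⟩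
  left_inv K := by apply Subtype.ext; funext i j; simp
  right_inv K := by apply Subtype.ext; funext i j; simp

lemma tourPerm_apply {n : ℕ} (σ : Equiv.Perm (Fin n)) (K : Tour n) (i j : Fin n) :
    (tourPerm σ K).1 i j = K.1 (σ i) (σ j) := rfl

lemma scK_perm {n : ℕ} (σ : Equiv.Perm (Fin n)) (K : Tour n) :
    scK (tourPerm σ K) = scK K ∘ σ := by
  funext i
  simp only [scK, tourPerm_apply, Function.comp]
  exact Equiv.sum_comp σ (fun j => K.1 (σ i) j)

lemma enK_perm {n : ℕ} (σ : Equiv.Perm (Fin n)) (K : Tour n) :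
    enK (tourPerm σ K) = enK K := by
  have h1 := two_enK K
  have h2 := two_enK (tourPerm σ K)
  have h3 : ∑ i, ∑ j, tri ((tourPerm σ K).1 i j) = ∑ i, ∑ j, tri (K.1 i j) := by
    simp only [tourPerm_apply]
    rw [← Equiv.sum_comp σ (fun i => ∑ j, tri (K.1 i j))]
    refine Finset.sum_congr rfl fun i _ => ?_
    exact Equiv.sum_comp σ (fun j => tri (K.1 (σ i) j))
  omega

lemma sgnK_perm {n : ℕ} (σ : Equiv.Perm (Fin n)) (K : Tour n) :
    sgnK (tourPerm σ K) = ((Equiv.Perm.sign σ : ℤ) : ℝ) * sgnK K := by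
  let f : Fin n → Fin n → ℝ := fun i j => if i = j then 0 else (-1 : ℝ) ^ (K.1 i j)
  have hf : ∀ i j, f i j = - f j i := by
    intro i j
    by_cases h : i = j
    · simp [f, h]
    · have h2 := K.2.2 i j h
      have h3 : K.1 j i = 1 - K.1 i j := by omega
      simp only [f, if_neg h, if_neg (Ne.symm h)]
      rw [h3, zpow_sub₀ (by norm_num)]
      rcases Int.even_or_odd (K.1 i j) with he | ho
      · rw [he.neg_one_zpow]; norm_num
      · rw [ho.neg_one_zpow]; norm_num
  have h := σ.prod_Ioi_comp_eq_sign_mul_prod hf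
  rw [← prod_pairs_Ioi, ← prod_pairs_Ioi n f] at h
  have e1 : sgnK (tourPerm σ K) = ∏ p ∈ prs n, f (σ p.1) (σ p.2) := by
    refine Finset.prod_congr rfl fun p hp => ?_
    have hlt : p.1 < p.2 := by simpa using hp
    have : σ p.1 ≠ σ p.2 := fun h => hlt.ne (σ.injective h)
    simp [f, tourPerm_apply, this]
  have e2 : sgnK K = ∏ p ∈ prs n, f p.1 p.2 := by
    refine Finset.prod_congr rfl fun p hp => ?_
    have hlt : p.1 < p.2 := by simpa using hp
    simp [f, hlt.ne]
  rw [e1, e2]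
  exact h

lemma ccK_perm {n : ℕ} (q : ℝ) (σ : Equiv.Perm (Fin n)) (m : Fin n → ℤ) :
    ccK q (m ∘ σ) = ((Equiv.Perm.sign σ : ℤ) : ℝ) * ccK q m := by
  unfold ccK
  rw [← (tourPerm σ).tsum_eq, ← tsum_mul_left]
  congr 1
  ext K
  have h : scK (tourPerm σ K) = m ∘ σ ↔ scK K = m := by
    rw [scK_perm]
    exact σ.surjective.injective_comp_right.eq_iff
  simp only [h]
  split_ifs
  · unfold wtK
    rw [sgnK_perm, enK_perm]; ring
  · simp

/-- shifting a tournament by a coboundary -/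
def tourShift {n : ℕ} (b : Fin n → ℤ) : Tour n ≃ Tour n where
  toFun K := ⟨fun i j => K.1 i j + (b i - b j), fun i => by simp [K.2.1 i], fun i j hij => by
    have := K.2.2 i j hij; linarith⟩
  invFun K := ⟨fun i j => K.1 i j - (b i - b j), fun i => by simp [K.2.1 i], fun i j hij => by
    have := K.2.2 i j hij; linarith⟩
  left_inv K := by apply Subtype.ext; funext i j; simp
  right_inv K := by apply Subtype.ext; funext i j; simp

lemma tourShift_apply {n : ℕ} (b : Fin n → ℤ) (K : Tour n) (i j : Fin n) :
    (tourShift b K).1 i j = K.1 i j + (b i - b j) := rfl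

lemma exp_zpow (x : ℝ) (k : ℤ) : Real.exp x ^ k = Real.exp (x * k) := by
  rw [← Real.rpow_intCast, ← Real.exp_mul]

lemma scK_shift {n : ℕ} (b : Fin n → ℤ) (hb : ∑ i, b i = 0) (K : Tour n) (i : Fin n) :
    scK (tourShift b K) i = scK K i + n * b i := by
  simp only [scK, tourShift_apply]
  rw [Finset.sum_add_distrib, Finset.sum_sub_distrib, hb]
  simp

lemma colK {n : ℕ} (K : Tour n) (j : Fin n) : ∑ i, K.1 i j = n - 1 - scK K j := by
  have h : ∑ i, K.1 i j + scK K j = ∑ i, if i = j then (0 : ℤ) else 1 := by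
    unfold scK
    rw [← Finset.sum_add_distrib]
    refine Finset.sum_congr rfl fun i _ => ?_
    split_ifs with h
    · subst h; rw [K.2.1]; rfl
    · exact K.2.2 i j h
  have h2 : ∑ i, (if i = j then (0 : ℤ) else 1) = n - 1 := by
    have : ∀ i, (if i = j then (0 : ℤ) else 1) = 1 - if i = j then 1 else 0 := by
      intro i; split_ifs <;> simp
    simp only [this, Finset.sum_sub_distrib]
    simp
  omega

lemma enK_shift {n : ℕ} (b : Fin n → ℤ) (hb : ∑ i, b i = 0) (K : Tour n) :
    2 * enK (tourShift b K) = 2 * enK K + 2 * ∑ i, scK K i * b i + n * ∑ i, b i ^ 2 := by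
  have h1 := two_enK K
  have h2 := two_enK (tourShift b K)
  have h3 : 2 * ∑ i, ∑ j, tri ((tourShift b K).1 i j) = 2 * ∑ i, ∑ j, tri (K.1 i j)
      + (4 * ∑ i, scK K i * b i + 2 * n * ∑ i, b i ^ 2) := by
    have e : ∀ i j, 2 * tri ((tourShift b K).1 i j) = 2 * tri (K.1 i j)
        + (2 * (K.1 i j * b i) - 2 * (K.1 i j * b j) + (b i ^ 2 + b j ^ 2 - 2 * (b i * b j)) - (b i - b j)) := by
      intro i j
      rw [two_tri, two_tri]
      simp only [tourShift_apply]
      ring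
    simp only [Finset.mul_sum, e]
    simp only [Finset.sum_add_distrib, Finset.sum_sub_distrib]
    have s1 : ∑ i, ∑ j, 2 * (K.1 i j * b i) = 2 * ∑ i, scK K i * b i := by
      rw [Finset.mul_sum]
      refine Finset.sum_congr rfl fun i _ => ?_
      rw [← Finset.mul_sum, ← Finset.sum_mul]; rfl
    have s2 : ∑ i, ∑ j, 2 * (K.1 i j * b j) = - (2 * ∑ i, scK K i * b i) := by
      rw [Finset.sum_comm]
      have : ∀ j, ∑ i, 2 * (K.1 i j * b j) = 2 * (n - 1) * b j - 2 * (scK K j * b j) := by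
        intro j
        rw [← Finset.mul_sum, ← Finset.sum_mul, colK]; ring
      simp only [this, Finset.sum_sub_distrib, ← Finset.mul_sum, hb]
      ring
    have s3 : ∑ i, ∑ j, 2 * (b i * b j) = 0 := by
      simp only [← Finset.mul_sum, hb]; simp
    rw [s1, s2, s3]
    simp only [Finset.sum_const, ← Finset.mul_sum, hb, ← Finset.sum_mul]
    simp only [Finset.card_univ, Fintype.card_fin, nsmul_eq_mul, ← Finset.mul_sum, hb]
    ring
  linarith

lemma sgnK_shift {n : ℕ} (b : Fin n → ℤ) (hb : ∑ i, b i = 0) (K : Tour n) :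
    sgnK (tourShift b K) = sgnK K := by
  unfold sgnK
  have e : ∀ p ∈ prs n, (-1 : ℝ) ^ ((tourShift b K).1 p.1 p.2)
      = (-1 : ℝ) ^ (K.1 p.1 p.2) * ((-1 : ℝ) ^ (b p.1) * (-1 : ℝ) ^ (b p.2)) := by
    intro p _
    simp only [tourShift_apply]
    rw [zpow_add₀ (by norm_num), zpow_sub₀ (by norm_num : (-1 : ℝ) ≠ 0)]
    congr 1
    rcases Int.even_or_odd (b p.2) with he | ho
    · rw [he.neg_one_zpow]; norm_num
    · rw [ho.neg_one_zpow]; ring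
  rw [Finset.prod_congr rfl e, Finset.prod_mul_distrib,
    prod_pairs n (fun i _ => (-1 : ℝ) ^ b i)]
  have h1 : ∏ i, ∏ j, (if i = j then (1 : ℝ) else (-1 : ℝ) ^ b i) = 1 := by
    have h2 : ∀ i : Fin n, ∏ j, (if i = j then (1 : ℝ) else (-1 : ℝ) ^ b i)
        = ((-1 : ℝ) ^ b i) ^ (n - 1) := by
      intro i
      rw [Finset.prod_ite]
      simp only [Finset.prod_const_one, one_mul, Finset.prod_const]
      congr 1
      have : Finset.univ.filter (fun j => ¬ i = j) = Finset.univ.erase i := by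
        ext j; simp [eq_comm]
      rw [this]; simp
    simp only [h2]
    rw [Finset.prod_pow]
    have h3 : ∏ i, (-1 : ℝ) ^ b i = (-1 : ℝ) ^ ∑ i, b i := by
      induction (Finset.univ : Finset (Fin n)) using Finset.induction_on with
      | empty => simp
      | insert a s ha ih => rw [Finset.prod_insert ha, Finset.sum_insert ha, zpow_add₀ (by norm_num), ih]
    rw [h3, hb]; simp
  rw [h1, mul_one]

lemma ccK_shift {n : ℕ} (t : ℝ) (b : Fin n → ℤ) (hb : ∑ i, b i = 0) (m : Fin n → ℤ) :
    ccK (Real.exp (-(2 * n * t))) (fun i => m i + n * b i) =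
      Real.exp (-(t * (2 * n * ∑ i, (m i : ℝ) * b i + n ^ 2 * ∑ i, (b i : ℝ) ^ 2)))
        * ccK (Real.exp (-(2 * n * t))) m := by
  unfold ccK
  rw [← (tourShift b).tsum_eq, ← tsum_mul_left]
  congr 1
  ext K
  have h : scK (tourShift b K) = (fun i => m i + n * b i) ↔ scK K = m := by
    constructor
    · intro h; funext i
      have := congrFun h i
      rw [scK_shift b hb] at this
      linarith
    · rintro rfl; funext i; rw [scK_shift b hb]
  simp only [h]
  split_ifs with hK
  · subst hK
    unfold wtK
    rw [sgnK_shift b hb]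
    have h2 : (2 : ℝ) * enK (tourShift b K)
        = 2 * enK K + 2 * ∑ i, (scK K i : ℝ) * b i + n * ∑ i, (b i : ℝ) ^ 2 := by
      exact_mod_cast enK_shift b hb K
    rw [exp_zpow, exp_zpow, mul_left_comm, ← Real.exp_add]
    congr 2
    linear_combination (-(n : ℝ) * t) * h2
  · simp

lemma ccK_sum {n : ℕ} (q : ℝ) (m : Fin n → ℤ) (h : 2 * ∑ i, m i ≠ n * (n - 1)) : ccK q m = 0 := by
  unfold ccK
  have : ∀ K : Tour n, (if scK K = m then wtK q K else 0) = 0 := by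
    intro K
    rw [if_neg]
    rintro rfl
    apply h
    have h1 : ∑ j, ∑ i, K.1 i j = ∑ j, ((n : ℤ) - 1 - scK K j) :=
      Finset.sum_congr rfl fun j _ => colK K j
    rw [Finset.sum_comm, Finset.sum_sub_distrib] at h1
    change ∑ i, scK K i = _ at h1
    simp at h1
    linarith
  simp only [this, tsum_zero]

/-- normalized coefficient -/
def dK {n : ℕ} (t : ℝ) (m : Fin n → ℤ) : ℝ :=
  ccK (Real.exp (-(2 * n * t))) m * Real.exp (t * ∑ i, (m i : ℝ) ^ 2)

lemma dK_perm {n : ℕ} (t : ℝ) (σ : Equiv.Perm (Fin n)) (m : Fin n → ℤ) :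
    dK t (m ∘ σ) = ((Equiv.Perm.sign σ : ℤ) : ℝ) * dK t m := by
  unfold dK
  rw [ccK_perm]
  have : ∑ i, ((m ∘ σ) i : ℝ) ^ 2 = ∑ i, (m i : ℝ) ^ 2 :=
    Equiv.sum_comp σ (fun i => (m i : ℝ) ^ 2)
  rw [this]; ring

lemma dK_shift {n : ℕ} (t : ℝ) (b : Fin n → ℤ) (hb : ∑ i, b i = 0) (m : Fin n → ℤ) :
    dK t (fun i => m i + n * b i) = dK t m := by
  unfold dK
  rw [ccK_shift t b hb, mul_comm (Real.exp _), mul_assoc, ← Real.exp_add]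
  congr 2
  have : ∑ i, (((m i + n * b i : ℤ)) : ℝ) ^ 2 = ∑ i, (m i : ℝ) ^ 2 + 2 * n * ∑ i, (m i : ℝ) * b i
      + n ^ 2 * ∑ i, (b i : ℝ) ^ 2 := by
    rw [Finset.mul_sum, Finset.mul_sum, ← Finset.sum_add_distrib, ← Finset.sum_add_distrib]
    refine Finset.sum_congr rfl fun i _ => ?_
    push_cast; ring
  rw [this]; ring

lemma dK_eq_zero {n : ℕ} (t : ℝ) (m : Fin n → ℤ) (i j : Fin n) (hij : i ≠ j) (c : ℤ)
    (h : m i = m j + n * c) : dK t m = 0 := by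
  let b : Fin n → ℤ := fun k => if k = i then -c else if k = j then c else 0
  have hb : ∑ k, b k = 0 := by
    have : ∀ k, b k = (if k = i then -c else 0) + (if k = j then c else 0) := by
      intro k
      by_cases h1 : k = i
      · subst h1; simp [b, hij]
      · simp [b, h1]
    simp [this, Finset.sum_add_distrib]
  have h1 := dK_shift t b hb m
  have h2 := dK_perm t (Equiv.swap i j) m
  have h3 : (fun k => m k + n * b k) = m ∘ Equiv.swap i j := by
    funext k
    simp only [Function.comp, b]
    by_cases hk : k = i
    · subst hk; simp [h]
    · by_cases hk2 : k = j
      · subst hk2; simp [hk, h]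
      · simp [hk, hk2, Equiv.swap_apply_of_ne_of_ne hk hk2]
  rw [h3, h2, Equiv.Perm.sign_swap hij] at h1
  simp at h1
  linarith

/-- sign of a map, zero if not bijective -/
def sgMap {n : ℕ} (r : Fin n → Fin n) : ℝ :=
  if h : Function.Bijective r then ((Equiv.Perm.sign (Equiv.ofBijective r h) : ℤ) : ℝ) else 0

/-- the base coefficient -/
def d0 (n : ℕ) (t : ℝ) : ℝ := dK (n := n) t (fun i => ((i : ℕ) : ℤ))

lemma two_sum_fin (n : ℕ) : 2 * ∑ i : Fin n, ((i : ℕ) : ℤ) = n * (n - 1) := by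
  rw [Fin.sum_univ_eq_sum_range (fun i => (i : ℤ)) n]
  induction n with
  | zero => simp
  | succ k ih => rw [Finset.sum_range_succ, mul_add, ih]; push_cast; ring

lemma dK_class {n : ℕ} (t : ℝ) (r : Fin n → Fin n) (b : Fin n → ℤ) :
    dK t (fun i => ((r i : ℕ) : ℤ) + n * b i) =
      if ∑ i, b i = 0 then sgMap r * d0 n t else 0 := by
  by_cases hr : Function.Bijective r
  · split_ifs with hb
    · rw [dK_shift t b hb]
      have := dK_perm t (Equiv.ofBijective r hr) (fun i => ((i : ℕ) : ℤ))
      unfold sgMap d0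
      rw [dif_pos hr, ← this]
      rfl
    · unfold dK
      rw [ccK_sum, zero_mul]
      rw [Finset.sum_add_distrib, ← Finset.mul_sum]
      have := Equiv.sum_comp (Equiv.ofBijective r hr) (fun i => ((i : ℕ) : ℤ))
      simp only [Equiv.ofBijective_apply] at this
      rw [this, mul_add, two_sum_fin]
      intro h
      have hn : (n : ℤ) ≠ 0 := by
        intro h0
        have h00 : n = 0 := by exact_mod_cast h0
        subst h00
        simp at hb
      have : (n : ℤ) * ∑ i, b i = 0 := by linarith
      rcases mul_eq_zero.mp this with h | h
      · exact hn h
      · exact hb h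
  · have h0 : sgMap r = 0 := by unfold sgMap; rw [dif_neg hr]
    rw [h0, zero_mul, ite_self]
    have hinj : ¬ Function.Injective r := fun h => hr (Finite.injective_iff_bijective.mp h)
    unfold Function.Injective at hinj
    push Not at hinj
    obtain ⟨i, j, h1, h2⟩ := hinj
    refine dK_eq_zero t _ i j h2 (b i - b j) ?_
    simp only [h1]; ring

end AuxSym

section AuxMacd

/-- residues and quotients -/
def resEquiv (n : ℕ) [NeZero n] : (Fin n → Fin n) × (Fin n → ℤ) ≃ (Fin n → ℤ) where
  toFun rb := fun i => ((rb.1 i : ℕ) : ℤ) + n * rb.2 i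
  invFun m := (fun i => (Int.divModEquiv n (m i)).2, fun i => (Int.divModEquiv n (m i)).1)
  left_inv rb := by
    have key : ∀ i, ((rb.1 i : ℕ) : ℤ) + n * rb.2 i = (Int.divModEquiv n).symm (rb.2 i, rb.1 i) := by
      intro i; simp [Int.divModEquiv]; ring
    simp only [key, Equiv.apply_symm_apply]
  right_inv m := by
    funext i
    have h := (Int.divModEquiv n).symm_apply_apply (m i)
    have key : ∀ p : ℤ × Fin n, ((p.2 : ℕ) : ℤ) + n * p.1 = (Int.divModEquiv n).symm p := by
      intro p; simp [Int.divModEquiv]; ring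
    simp only [key, h]

lemma resEquiv_apply (n : ℕ) [NeZero n] (rb : (Fin n → Fin n) × (Fin n → ℤ)) (i : Fin n) :
    resEquiv n rb i = ((rb.1 i : ℕ) : ℤ) + n * rb.2 i := rfl

lemma macd2 {𝕜 : Type*} [RCLike 𝕜] {n : ℕ} [NeZero n] (t : ℝ) (ht : 0 < t)
    (z : Fin n → 𝕜) (hz : ∀ i, z i ≠ 0) :
    HasSum (fun rb : (Fin n → Fin n) × (Fin n → ℤ) =>
      (((if ∑ i, rb.2 i = 0 then sgMap rb.1 * d0 n t else 0) *
        Real.exp (-(t * ∑ i, (((rb.1 i : ℕ) : ℝ) + n * rb.2 i) ^ 2)) : ℝ) : 𝕜) *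
        ∏ i, z i ^ ((((rb.1 i : ℕ) : ℤ) + n * rb.2 i) - (i : ℕ)))
      (∏ p ∈ prs n, thP ((Real.exp (-(2 * n * t)) : ℝ) : 𝕜) (z p.1 / z p.2)) := by
  have hn : (0 : ℝ) < n := by exact_mod_cast Nat.pos_of_ne_zero (NeZero.ne n)
  have hq1 : Real.exp (-(2 * n * t)) < 1 := by
    rw [Real.exp_lt_one_iff]; have := mul_pos hn ht; linarith
  have h := macd1 (Real.exp (-(2 * n * t))) (Real.exp_pos _) hq1 z hz
  rw [← (resEquiv n).hasSum_iff] at h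
  refine h.congr_fun fun rb => ?_
  simp only [Function.comp]
  congr 2
  rw [← dK_class]
  unfold dK
  rw [mul_assoc, ← Real.exp_add]
  have : (t * ∑ i, (((((rb.1 i : ℕ) : ℤ) + n * rb.2 i : ℤ)) : ℝ) ^ 2
    + -(t * ∑ i, (((rb.1 i : ℕ) : ℝ) + n * rb.2 i) ^ 2)) = 0 := by push_cast; ring
  rw [this, Real.exp_zero, mul_one]
  rfl

lemma gauss1 (t : ℝ) (ht : 0 < t) (n : ℕ) [NeZero n] : ∃ C, ∀ v : ℝ,
    (Summable fun k : ℤ => Real.exp (-(t * (v + n * k) ^ 2))) ∧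
      ∑' k : ℤ, Real.exp (-(t * (v + n * k) ^ 2)) ≤ C := by
  have hn : (0 : ℝ) < n := by exact_mod_cast Nat.pos_of_ne_zero (NeZero.ne n)
  have hs := (summable_gauss (t * n ^ 2 / 2) 0 (by positivity)).mul_left (Real.exp (t * n ^ 2))
  refine ⟨∑' k : ℤ, Real.exp (t * n ^ 2) * Real.exp (-(t * n ^ 2 / 2) * (k : ℝ) ^ 2 + 0 * k),
    fun v => ?_⟩
  have hb : ∀ k : ℤ, Real.exp (-(t * (v + n * ((Equiv.subRight ⌊v / n⌋) k : ℤ)) ^ 2)) ≤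
      Real.exp (t * n ^ 2) * Real.exp (-(t * n ^ 2 / 2) * (k : ℝ) ^ 2 + 0 * k) := by
    intro k
    rw [← Real.exp_add]
    apply Real.exp_le_exp.mpr
    have hf0 := Int.fract_nonneg (v / n)
    have hf1 := Int.fract_lt_one (v / n)
    have hv : v = n * (⌊v / n⌋ + Int.fract (v / n)) := by
      rw [Int.floor_add_fract]; field_simp
    set f := Int.fract (v / n)
    have e : v + n * ((Equiv.subRight ⌊v / n⌋) k : ℤ) = n * (k + f) := by
      simp only [Equiv.subRight_apply]
      push_cast
      linear_combination hv
    rw [e]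
    have h1 : (k : ℝ) ^ 2 / 2 - 1 ≤ (k + f) ^ 2 := by nlinarith [sq_nonneg ((k : ℝ) + 2 * f)]
    have h2 : 0 < t * n ^ 2 := by positivity
    nlinarith
  · have hsum := Summable.of_nonneg_of_le (fun k => (Real.exp_pos _).le) hb hs
    refine ⟨(Equiv.subRight ⌊v / n⌋).summable_iff.mp hsum, ?_⟩
    rw [← (Equiv.subRight ⌊v / n⌋).tsum_eq]
    exact hsum.tsum_le_tsum hb hs

lemma gaussN (t : ℝ) (ht : 0 < t) (n : ℕ) [NeZero n] : ∃ C, ∀ v : Fin n → ℝ,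
    (Summable fun b : Fin n → ℤ => Real.exp (-(t * ∑ i, (v i + n * b i) ^ 2))) ∧
      ∑' b : Fin n → ℤ, Real.exp (-(t * ∑ i, (v i + n * b i) ^ 2)) ≤ C := by
  obtain ⟨C, hC⟩ := gauss1 t ht n
  refine ⟨C ^ n, fun v => ?_⟩
  have h := pi_prod_hasSum (𝕜 := ℝ) ℤ (Fin n) (fun i k => Real.exp (-(t * (v i + n * k) ^ 2)))
    (fun i => by simpa using (hC (v i)).1)
  have e : ∀ b : Fin n → ℤ, ∏ i, Real.exp (-(t * (v i + n * b i) ^ 2))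
      = Real.exp (-(t * ∑ i, (v i + n * b i) ^ 2)) := by
    intro b
    rw [← Real.exp_sum, Finset.sum_neg_distrib, Finset.mul_sum]
  simp only [e] at h
  refine ⟨h.2.summable, ?_⟩
  rw [h.2.tsum_eq]
  calc _ ≤ ∏ i : Fin n, C := Finset.prod_le_prod
        (fun i _ => tsum_nonneg fun k => (Real.exp_pos _).le) (fun i _ => (hC (v i)).2)
    _ = C ^ n := by simp

/-- core sums -/
def hhA (n : ℕ) (t : ℝ) (a : ℤ) : ℝ :=
  ∑' b : Fin n → ℤ, if ∑ i, b i = a then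
    Real.exp (-(t * ∑ i : Fin n, (((i : ℕ) : ℝ) + n * b i - a) ^ 2)) else 0

/-- rotation -/
def rotB (k : ℕ) : (Fin (k + 1) → ℤ) ≃ (Fin (k + 1) → ℤ) :=
  ((finRotate (k + 1)).symm.arrowCongr (Equiv.refl ℤ)).trans
    (Equiv.subRight (fun j => if j = Fin.last k then (1 : ℤ) else 0))

lemma rotB_apply (k : ℕ) (b : Fin (k + 1) → ℤ) (j : Fin (k + 1)) :
    rotB k b j = b (finRotate (k + 1) j) - if j = Fin.last k then 1 else 0 := rfl

lemma hhA_succ (k : ℕ) (t : ℝ) (a : ℤ) : hhA (k + 1) t (a + 1) = hhA (k + 1) t a := by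
  unfold hhA
  rw [← (rotB k).tsum_eq (fun b => if ∑ i, b i = a then
    Real.exp (-(t * ∑ i : Fin (k + 1), (((i : ℕ) : ℝ) + (k + 1 : ℕ) * b i - a) ^ 2)) else 0)]
  congr 1
  ext b
  have h1 : ∑ i, rotB k b i = ∑ i, b i - 1 := by
    simp only [rotB_apply, Finset.sum_sub_distrib]
    rw [Equiv.sum_comp (finRotate (k + 1)) b]
    simp
  have h2 : ∑ i : Fin (k + 1), (((i : ℕ) : ℝ) + (k + 1 : ℕ) * b i - (a + 1 : ℤ)) ^ 2
      = ∑ i : Fin (k + 1), (((i : ℕ) : ℝ) + (k + 1 : ℕ) * (rotB k b i : ℤ) - a) ^ 2 := by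
    rw [← Equiv.sum_comp (finRotate (k + 1))]
    refine Finset.sum_congr rfl fun i _ => ?_
    congr 1
    rw [rotB_apply]
    by_cases hi : i = Fin.last k
    · subst hi
      simp
      ring
    · have hlt : (i : ℕ) < k := by
        have := i.2
        have h3 : (i : ℕ) ≠ k := fun h => hi (Fin.ext h)
        omega
      have h4 : ((finRotate (k + 1) i : Fin (k + 1)) : ℕ) = i + 1 := coe_finRotate_of_ne_last hi
      rw [h4, if_neg hi]
      push_cast
      ring
  rw [h1, h2]
  have h3 : (∑ i, b i = a + 1) ↔ (∑ i, b i - 1 = a) := by omega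
  simp only [h3]

lemma hhA_eq (n : ℕ) [NeZero n] (t : ℝ) (a : ℤ) : hhA n t a = hhA n t 0 := by
  obtain ⟨k, rfl⟩ : ∃ k, n = k + 1 := ⟨n - 1, by have := NeZero.ne n; omega⟩
  induction a using Int.induction_on with
  | zero => rfl
  | succ i ih => rw [hhA_succ, ih]
  | pred i ih => rw [← ih, ← hhA_succ k t (-(i : ℤ) - 1)]; congr 1; ring

end AuxMacd

section AuxH
open Filter Topology

lemma qPf_split {𝕜 : Type*} [NormedField 𝕜] (w q : 𝕜) (n N : ℕ) :
    qPf w q (n * N) = ∏ j : Fin n, qPf (w * q ^ (j : ℕ)) (q ^ n) N := by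
  induction N with
  | zero => simp [qPf]
  | succ N ih =>
    have h1 : ∀ j : Fin n, qPf (w * q ^ (j : ℕ)) (q ^ n) (N + 1)
        = qPf (w * q ^ (j : ℕ)) (q ^ n) N * (1 - w * q ^ (n * N + (j : ℕ))) := by
      intro j
      unfold qPf
      rw [Finset.prod_range_succ]
      congr 2
      rw [pow_add, pow_mul]; ring
    rw [Finset.prod_congr rfl fun j _ => h1 j, Finset.prod_mul_distrib, ← ih, mul_add, mul_one,
      Fin.prod_univ_eq_prod_range (fun j => (1 - w * q ^ (n * N + j))) n]
    unfold qPf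
    rw [Finset.prod_range_add]

lemma qP_split {𝕜 : Type*} [NormedField 𝕜] [CompleteSpace 𝕜] (w q : 𝕜) (hq : ‖q‖ < 1)
    (n : ℕ) (hn : n ≠ 0) :
    ∏ j : Fin n, qP (w * q ^ (j : ℕ)) (q ^ n) = qP w q := by
  have hqn : ‖q ^ n‖ < 1 := by rw [norm_pow]; exact pow_lt_one₀ (norm_nonneg _) hq hn
  have h1 : Tendsto (fun N => ∏ j : Fin n, qPf (w * q ^ (j : ℕ)) (q ^ n) N) atTop
      (𝓝 (∏ j : Fin n, qP (w * q ^ (j : ℕ)) (q ^ n))) :=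
    tendsto_finsetProd _ fun j _ => qP_tendsto _ _ hqn
  have h2 : Tendsto (fun N => qPf w q (n * N)) atTop (𝓝 (qP w q)) :=
    (qP_tendsto w q hq).comp (tendsto_id.const_mul_atTop' (Nat.pos_of_ne_zero hn))
  simp only [qPf_split] at h2
  exact tendsto_nhds_unique h1 h2

lemma gauss_theta (A B : ℝ) (hA : 0 < A) :
    HasSum (fun k : ℤ => Real.exp (-(A * (k : ℝ) ^ 2 + B * k)))
      (qP (-Real.exp (-(A + B))) (Real.exp (-(2 * A))) *
        qP (-Real.exp (-(A - B))) (Real.exp (-(2 * A))) *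
        qP (Real.exp (-(2 * A))) (Real.exp (-(2 * A)))) := by
  have hq : ‖Real.exp (-(2 * A))‖ < 1 := by
    rw [Real.norm_eq_abs, abs_of_pos (Real.exp_pos _), Real.exp_lt_one_iff]; linarith
  have h := jacobi_triple (Real.exp (-(2 * A))) (-Real.exp (-(A + B))) (Real.exp_pos _).ne' hq
    (neg_ne_zero.mpr (Real.exp_pos _).ne')
  have e : Real.exp (-(2 * A)) * (-Real.exp (-(A + B)))⁻¹ = -Real.exp (-(A - B)) := by
    rw [inv_neg, ← Real.exp_neg, mul_neg, ← Real.exp_add]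
    congr 2; ring
  rw [e] at h
  refine h.congr_fun fun k => ?_
  have h2 : (-Real.exp (-(A + B))) ^ k = (-1) ^ k * Real.exp (-(A + B)) ^ k := by
    rw [← mul_zpow]; simp
  have h3 : (2 : ℝ) * (tri k : ℝ) = k * (k - 1) := by exact_mod_cast two_tri k
  rw [h2, exp_zpow, exp_zpow]
  have h4 : ((-1 : ℝ) ^ k) * (-1) ^ k = 1 := by
    rw [← mul_zpow]; simp
  have h5 : Real.exp (-(A * (k : ℝ) ^ 2 + B * k)) =
      Real.exp (-(2 * A) * (tri k : ℝ)) * Real.exp (-(A + B) * k) := by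
    rw [← Real.exp_add]; congr 1; linear_combination A * h3
  rw [h5]
  linear_combination (-(Real.exp (-(2 * A) * (tri k : ℝ)) * Real.exp (-(A + B) * k))) * h4

lemma sum_fin_real (n : ℕ) : 2 * ∑ i : Fin n, ((i : ℕ) : ℝ) = n * (n - 1) := by
  exact_mod_cast two_sum_fin n

lemma hh_fiber (n : ℕ) (b : Fin n → ℤ) (a : ℤ) (h : ∑ i, b i = a) :
    ∑ i : Fin n, (((i : ℕ) : ℝ) + n * b i) ^ 2 =
      ∑ i : Fin n, (((i : ℕ) : ℝ) + n * b i - a) ^ 2 + (n * (a : ℝ) ^ 2 + n * (n - 1) * a) := by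
  have h' : ∑ i, (b i : ℝ) = a := by exact_mod_cast h
  have e : ∀ i : Fin n, (((i : ℕ) : ℝ) + n * b i - a) ^ 2 = (((i : ℕ) : ℝ) + n * b i) ^ 2
      - 2 * a * ((i : ℕ) : ℝ) - (2 * a * n) * b i + (a : ℝ) ^ 2 := by intro i; ring
  simp only [e, Finset.sum_add_distrib, Finset.sum_sub_distrib, ← Finset.mul_sum, h']
  have := sum_fin_real n
  simp only [Finset.sum_const, Finset.card_univ, Fintype.card_fin, nsmul_eq_mul]
  linear_combination (a : ℝ) * this

lemma hh_eval (n : ℕ) [NeZero n] (t : ℝ) (ht : 0 < t) :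
    hhA n t 0 * qP (Real.exp (-(2 * n * t))) (Real.exp (-(2 * n * t))) =
      Real.exp (-(t * ∑ i : Fin n, ((i : ℕ) : ℝ) ^ 2)) *
        (qP (Real.exp (-(2 * n * t)) ^ n) (Real.exp (-(2 * n * t)) ^ n)) ^ n := by
  have hn : (0 : ℝ) < n := by exact_mod_cast Nat.pos_of_ne_zero (NeZero.ne n)
  set q := Real.exp (-(2 * n * t)) with hqdef
  have hq1 : ‖q‖ < 1 := by
    rw [Real.norm_eq_abs, abs_of_pos (Real.exp_pos _), Real.exp_lt_one_iff]
    have := mul_pos hn ht; linarith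
  have hQ : Real.exp (-(2 * (t * n ^ 2))) = q ^ n := by
    rw [hqdef, ← Real.exp_nat_mul]; congr 1; ring
  have hQ' : Real.exp (-(2 * (t * n))) = q := by
    rw [hqdef]; congr 1; ring
  have hq0 : 0 < q := Real.exp_pos _
  set w := -Real.exp (-(t * n ^ 2)) with hw
  set w' := -Real.exp (-(t * n - t * (n * (n - 1)))) with hw'
  have hj : ∀ j : Fin n, HasSum (fun k : ℤ => Real.exp (-(t * (((j : ℕ) : ℝ) + n * k) ^ 2)))
      (Real.exp (-(t * ((j : ℕ) : ℝ) ^ 2)) * (qP (w * q ^ (j : ℕ)) (q ^ n) *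
        qP (w' * q ^ (n - 1 - (j : ℕ))) (q ^ n) * qP (q ^ n) (q ^ n))) := by
    intro j
    have h := (gauss_theta (t * n ^ 2) (2 * t * n * (j : ℕ)) (by positivity)).mul_left
      (Real.exp (-(t * ((j : ℕ) : ℝ) ^ 2)))
    rw [hQ] at h
    have e1 : -Real.exp (-(t * n ^ 2 + 2 * t * n * (j : ℕ))) = w * q ^ (j : ℕ) := by
      rw [hw, hqdef, ← Real.exp_nat_mul, neg_mul, ← Real.exp_add]; congr 2; ring
    have e2 : -Real.exp (-(t * n ^ 2 - 2 * t * n * (j : ℕ))) = w' * q ^ (n - 1 - (j : ℕ)) := by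
      rw [hw', hqdef, ← Real.exp_nat_mul, neg_mul, ← Real.exp_add]; congr 2
      have := j.2
      have h3 : ((n - 1 - (j : ℕ) : ℕ) : ℝ) = n - 1 - (j : ℕ) := by
        rw [Nat.cast_sub (by omega), Nat.cast_sub (by omega)]; simp
      rw [h3]; ring
    rw [e1, e2] at h
    refine h.congr_fun fun k => ?_
    rw [← Real.exp_add]; congr 1; ring
  have hprod := (pi_prod_hasSum (𝕜 := ℝ) ℤ (Fin n)
    (fun j k => Real.exp (-(t * (((j : ℕ) : ℝ) + n * k) ^ 2)))
    (fun j => by simpa using (hj j).summable)).2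
  have hP : ∏ j : Fin n, ∑' k : ℤ, Real.exp (-(t * (((j : ℕ) : ℝ) + n * k) ^ 2)) =
      Real.exp (-(t * ∑ i : Fin n, ((i : ℕ) : ℝ) ^ 2)) * (qP w q * qP w' q *
        qP (q ^ n) (q ^ n) ^ n) := by
    rw [Finset.prod_congr rfl fun j _ => (hj j).tsum_eq]
    rw [Finset.prod_mul_distrib, Finset.prod_mul_distrib, Finset.prod_mul_distrib,
      qP_split w q hq1 n (NeZero.ne n), ← Real.exp_sum, Finset.sum_neg_distrib, ← Finset.mul_sum]
    congr 3
    · congr 1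
      rw [← qP_split w' q hq1 n (NeZero.ne n), ← Equiv.prod_comp Fin.revPerm]
      refine Finset.prod_congr rfl fun j _ => ?_
      congr 3
      simp [Fin.val_rev]; omega
    · simp
  rw [hP] at hprod
  have hfib := hprod.tsum_fiberwise (fun b : Fin n → ℤ => ∑ i, b i)
  have hsum2 := (gauss_theta (t * n) (t * (n * (n - 1))) (by positivity)).mul_left (hhA n t 0)
  have e3 : -Real.exp (-(t * n + t * (n * (n - 1)))) = w := by
    rw [hw]; congr 3; ring
  rw [hQ', e3, ← hw'] at hsum2
  have hfib2 : HasSum (fun a : ℤ => hhA n t 0 * Real.exp (-(t * n * (a : ℝ) ^ 2 + t * (n * (n - 1)) * a)))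
      (Real.exp (-(t * ∑ i : Fin n, ((i : ℕ) : ℝ) ^ 2)) * (qP w q * qP w' q *
        qP (q ^ n) (q ^ n) ^ n)) := by
    refine hfib.congr_fun fun a => ?_
    rw [tsum_subtype ((fun b : Fin n → ℤ => ∑ i, b i) ⁻¹' {a})
      (fun b : Fin n → ℤ => ∏ i : Fin n, Real.exp (-(t * (((i : ℕ) : ℝ) + n * b i) ^ 2)))]
    rw [← hhA_eq n t a]
    unfold hhA
    rw [← tsum_mul_right]
    congr 1
    ext b
    have he : ∏ i : Fin n, Real.exp (-(t * (((i : ℕ) : ℝ) + n * b i) ^ 2)) =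
        Real.exp (-(t * ∑ i : Fin n, (((i : ℕ) : ℝ) + n * b i) ^ 2)) := by
      rw [← Real.exp_sum, Finset.sum_neg_distrib, ← Finset.mul_sum]
    by_cases hb : ∑ i, b i = a
    · rw [if_pos hb, Set.indicator_of_mem (by simpa using hb), he, hh_fiber n b a hb, ← Real.exp_add]
      congr 1; ring
    · rw [if_neg hb, Set.indicator_of_notMem (by simpa using hb)]; simp
  have heq := hsum2.unique hfib2
  have hneg : ∀ y : ℝ, qP (-Real.exp y) q ≠ 0 := by
    intro y
    apply qP_ne_zero _ _ hq1
    intro k hk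
    have : 0 < Real.exp y * q ^ k := by positivity
    rw [neg_mul] at hk
    linarith
  have h1 : qP w q ≠ 0 := hneg _
  have h2 : qP w' q ≠ 0 := hneg _
  apply mul_left_cancel₀ (mul_ne_zero h1 h2)
  linear_combination heq

end AuxH

section AuxD
open Filter Topology

lemma root_prod {n : ℕ} [NeZero n] {ζ : ℂ} (hζ : IsPrimitiveRoot ζ n) (v : ℂ) :
    ∏ s : Fin n, (1 - ζ ^ (s : ℕ) * v) = 1 - v ^ n := by
  have hn : 0 < n := Nat.pos_of_ne_zero (NeZero.ne n)
  have h := hζ.pow_sub_pow_eq_prod_sub_mul 1 v hn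
  rw [one_pow] at h
  rw [h]
  refine Finset.prod_nbij (fun s : Fin n => ζ ^ (s : ℕ)) ?_ ?_ ?_ ?_
  · intro s _
    rw [Polynomial.mem_nthRootsFinset hn, ← pow_mul, mul_comm, pow_mul, hζ.pow_eq_one, one_pow]
  · intro s _ s' _ h
    exact Fin.ext (hζ.pow_inj s.2 s'.2 h)
  · intro y hy
    rw [Finset.mem_coe, Polynomial.mem_nthRootsFinset hn] at hy
    obtain ⟨k, hk, rfl⟩ := hζ.eq_pow_of_pow_eq_one hy
    exact ⟨⟨k, hk⟩, by simp, rfl⟩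
  · intro s _; rfl

lemma qP_root {n : ℕ} [NeZero n] {ζ : ℂ} (hζ : IsPrimitiveRoot ζ n) (w q : ℂ) (hq : ‖q‖ < 1) :
    ∏ s : Fin n, qP (ζ ^ (s : ℕ) * w) q = qP (w ^ n) (q ^ n) := by
  have hqn : ‖q ^ n‖ < 1 := by rw [norm_pow]; exact pow_lt_one₀ (norm_nonneg _) hq (NeZero.ne n)
  have h1 : Tendsto (fun N => ∏ s : Fin n, qPf (ζ ^ (s : ℕ) * w) q N) atTop
      (𝓝 (∏ s : Fin n, qP (ζ ^ (s : ℕ) * w) q)) :=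
    tendsto_finsetProd _ fun j _ => qP_tendsto _ _ hq
  have h2 := qP_tendsto (w ^ n) (q ^ n) hqn
  have e : ∀ N, ∏ s : Fin n, qPf (ζ ^ (s : ℕ) * w) q N = qPf (w ^ n) (q ^ n) N := by
    intro N
    unfold qPf
    rw [Finset.prod_comm]
    refine Finset.prod_congr rfl fun k _ => ?_
    rw [← pow_mul, mul_comm n k, pow_mul, ← mul_pow, ← root_prod hζ]
    simp only [mul_assoc]
  simp only [e] at h1
  exact tendsto_nhds_unique h1 h2

lemma qP_ofReal (z q : ℝ) (hq : ‖q‖ < 1) : ((qP z q : ℝ) : ℂ) = qP (z : ℂ) (q : ℂ) := by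
  have h1 := (Complex.continuous_ofReal.tendsto _).comp (qP_tendsto z q hq)
  have h2 := qP_tendsto (z : ℂ) (q : ℂ) (by simpa using hq)
  refine tendsto_nhds_unique (h1.congr fun N => ?_) h2
  simp [qPf]

lemma qP_first {𝕜 : Type*} [NormedField 𝕜] [CompleteSpace 𝕜] (z q : 𝕜) (hq : ‖q‖ < 1) :
    qP z q = (1 - z) * qP (z * q) q := by
  have h1 := (qP_tendsto z q hq).comp (tendsto_add_atTop_nat 1)
  have h2 := (qP_tendsto (z * q) q hq).const_mul (1 - z)
  refine tendsto_nhds_unique (h1.congr fun N => ?_) h2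
  simp only [Function.comp, qPf]
  rw [Finset.prod_range_succ', mul_comm]
  simp [pow_succ', mul_assoc]

lemma sgMap_perm {n : ℕ} (σ : Equiv.Perm (Fin n)) :
    sgMap (σ : Fin n → Fin n) = ((Equiv.Perm.sign σ : ℤ) : ℝ) := by
  unfold sgMap
  rw [dif_pos σ.bijective]
  congr 3
  ext i; rfl

lemma sum_sgMap {n : ℕ} (g : (Fin n → Fin n) → ℂ) :
    ∑ r : Fin n → Fin n, ((sgMap r : ℝ) : ℂ) * g r
      = ∑ σ : Equiv.Perm (Fin n), ((Equiv.Perm.sign σ : ℤ) : ℂ) * g σ := by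
  symm
  refine Finset.sum_of_injOn (fun σ : Equiv.Perm (Fin n) => (σ : Fin n → Fin n)) ?_ ?_ ?_ ?_
  · intro σ _ τ _ h; exact DFunLike.coe_injective h
  · intro σ _; simp
  · intro r _ hr
    have : ¬ Function.Bijective r := fun h => hr ⟨Equiv.ofBijective r h, by simp, rfl⟩
    unfold sgMap
    rw [dif_neg this]; simp
  · intro σ _
    rw [sgMap_perm]; simp

lemma hh_perm (n : ℕ) [NeZero n] (t : ℝ) (ht : 0 < t) (σ : Equiv.Perm (Fin n))
    (b' : Fin n → ℤ) (hb' : ∑ i, b' i = 0) (a : ℤ) :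
    HasSum (fun b : Fin n → ℤ => if ∑ i, b i = a then
      Real.exp (-(t * ∑ i, (((σ i : ℕ) : ℝ) + n * b' i + n * b i - a) ^ 2)) else 0)
      (hhA n t 0) := by
  rw [← hhA_eq n t a]
  let F : (Fin n → ℤ) → ℝ := fun b => if ∑ i, b i = a then
      Real.exp (-(t * ∑ i : Fin n, (((i : ℕ) : ℝ) + n * b i - a) ^ 2)) else 0
  have hF : HasSum F (hhA n t a) := by
    apply Summable.hasSum
    obtain ⟨C, hC⟩ := gaussN t ht n
    refine Summable.of_nonneg_of_le ?_ ?_ (hC (fun i => ((i : ℕ) : ℝ) - a)).1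
    · intro b; simp only [F]; split_ifs
      · positivity
      · rfl
    · intro b; simp only [F]; split_ifs
      · apply le_of_eq; congr 3
        refine Finset.sum_congr rfl fun i _ => ?_
        ring
      · positivity
  let e : (Fin n → ℤ) ≃ (Fin n → ℤ) := (Equiv.addRight b').trans (σ.arrowCongr (Equiv.refl ℤ))
  have he : ∀ b i, e b (σ i) = b i + b' i := by
    intro b i; simp [e, Equiv.arrowCongr]
  rw [← e.hasSum_iff] at hF
  refine hF.congr_fun fun b => ?_
  simp only [Function.comp, F]
  have h1 : ∑ i, e b i = ∑ i, b i := by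
    rw [← Equiv.sum_comp σ]
    simp only [he, Finset.sum_add_distrib, hb', add_zero]
  have h2 : ∑ i : Fin n, (((i : ℕ) : ℝ) + n * (e b i : ℤ) - a) ^ 2 =
      ∑ i, (((σ i : ℕ) : ℝ) + n * b' i + n * b i - a) ^ 2 := by
    rw [← Equiv.sum_comp σ]
    refine Finset.sum_congr rfl fun i _ => ?_
    rw [he]; push_cast; ring
  rw [h1, h2]

lemma card_prs (n : ℕ) : (prs n).card = (n - 1) * (n - 2) / 2 + (n - 1) := by
  have h := prod_pairs_snd n (fun _ => Multiplicative.ofAdd (1 : ℕ))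
  have h2 : (prs n).card = ∑ j : Fin n, (j : ℕ) := by
    have := congrArg Multiplicative.toAdd h
    simpa [toAdd_prod] using this
  rw [h2, Fin.sum_univ_eq_sum_range (fun i => i) n, Finset.sum_range_id]
  rcases n with _ | _ | n
  · rfl
  · rfl
  · simp only [Nat.add_sub_cancel]
    have h4 : (n + 1 + 1 - 2) = n := rfl
    rw [h4, ← Nat.add_mul_div_right _ _ (by norm_num : 0 < 2)]
    congr 1; ring

lemma d0_aux (n : ℕ) [NeZero n] (t : ℝ) (ht : 0 < t) (q : ℝ) (hqd : q = Real.exp (-(2 * n * t))) :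
    d0 n t * hhA n t 0 * (qP q q) ^ n = (qP q q) ^ (prs n).card * (qP (q ^ n) (q ^ n)) ^ n := by
  have hn : (0 : ℝ) < n := by exact_mod_cast Nat.pos_of_ne_zero (NeZero.ne n)
  have hq1 : ‖q‖ < 1 := by
    rw [hqd, Real.norm_eq_abs, abs_of_pos (Real.exp_pos _), Real.exp_lt_one_iff]
    have := mul_pos hn ht; linarith
  have hqn : ‖q ^ n‖ < 1 := by rw [norm_pow]; exact pow_lt_one₀ (norm_nonneg _) hq1 (NeZero.ne n)
  have hqc : ‖(q : ℂ)‖ < 1 := by simpa using hq1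
  obtain ⟨ζ, hζ⟩ : ∃ ζ : ℂ, IsPrimitiveRoot ζ n :=
    ⟨_, Complex.isPrimitiveRoot_exp n (NeZero.ne n)⟩
  have hζ0 : ζ ≠ 0 := hζ.ne_zero (NeZero.ne n)
  let z : Fin n → ℂ := fun i => ζ ^ (i : ℕ)
  have hz : ∀ i, z i ≠ 0 := fun i => pow_ne_zero _ hζ0
  have hm := macd2 (𝕜 := ℂ) t ht z hz
  rw [← hqd] at hm
  set E : ℂ := ∏ i : Fin n, ((z i)⁻¹) ^ (i : ℕ) with hE
  have hE0 : E ≠ 0 := Finset.prod_ne_zero_iff.mpr fun i _ => pow_ne_zero _ (inv_ne_zero (hz i))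
  have hterm : ∀ rb : (Fin n → Fin n) × (Fin n → ℤ),
      ∏ i, z i ^ ((((rb.1 i : ℕ) : ℤ) + n * rb.2 i) - (i : ℕ))
        = E * ∏ i, z (rb.1 i) ^ (i : ℕ) := by
    intro rb
    rw [hE, ← Finset.prod_mul_distrib]
    refine Finset.prod_congr rfl fun i _ => ?_
    have h1 : z i ^ n = 1 := by
      simp only [z]; rw [← pow_mul, mul_comm, pow_mul, hζ.pow_eq_one, one_pow]
    rw [zpow_sub₀ (hz i), zpow_add₀ (hz i), zpow_mul, zpow_natCast, zpow_natCast, zpow_natCast, h1,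
      one_zpow, mul_one, inv_pow, div_eq_mul_inv, mul_comm]
    congr 1
    simp only [z]
    rw [← pow_mul, ← pow_mul, mul_comm]
  have hr : ∀ r : Fin n → Fin n, HasSum (fun b : Fin n → ℤ =>
      (((if ∑ i, b i = 0 then sgMap r * d0 n t else 0) *
        Real.exp (-(t * ∑ i, (((r i : ℕ) : ℝ) + n * b i) ^ 2)) : ℝ) : ℂ) *
        ∏ i, z i ^ ((((r i : ℕ) : ℤ) + n * b i) - (i : ℕ)))
      (((sgMap r : ℝ) : ℂ) * ((((d0 n t * hhA n t 0 : ℝ)) : ℂ) * E * ∏ i, z (r i) ^ (i : ℕ))) := by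
    intro r
    have h2 : ∀ b : Fin n → ℤ, ∏ i, z i ^ ((((r i : ℕ) : ℤ) + n * b i) - (i : ℕ))
        = E * ∏ i, z (r i) ^ (i : ℕ) := fun b => hterm (r, b)
    simp only [h2]
    have h3 : HasSum (fun b : Fin n → ℤ => (if ∑ i, b i = 0 then sgMap r * d0 n t else 0) *
        Real.exp (-(t * ∑ i, (((r i : ℕ) : ℝ) + n * b i) ^ 2)))
        (sgMap r * (d0 n t * hhA n t 0)) := by
      by_cases hb : Function.Bijective r
      · have h4 := (hh_perm n t ht (Equiv.ofBijective r hb) 0 (by simp) 0).mul_left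
          (sgMap r * d0 n t)
        rw [mul_assoc] at h4
        refine h4.congr_fun fun b => ?_
        by_cases hs : ∑ i, b i = 0
        · simp [hs]
        · simp [hs]
      · have : sgMap r = 0 := by unfold sgMap; rw [dif_neg hb]
        simp only [this, zero_mul, ite_self]
        exact hasSum_zero
    have h5 := ((Complex.hasSum_ofReal).mpr h3).mul_right (E * ∏ i, z (r i) ^ (i : ℕ))
    have h6 : ((sgMap r : ℝ) : ℂ) * ((((d0 n t * hhA n t 0 : ℝ)) : ℂ) * E * ∏ i, z (r i) ^ (i : ℕ))
        = ((sgMap r * (d0 n t * hhA n t 0) : ℝ) : ℂ) * (E * ∏ i, z (r i) ^ (i : ℕ)) := by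
      push_cast; ring
    rw [h6]
    exact h5
  have hfib := hm.prod_fiberwise hr
  have hsum := hfib.unique (hasSum_fintype _)
  rw [sum_sgMap (fun r => (((d0 n t * hhA n t 0 : ℝ)) : ℂ) * E * ∏ i, z (r i) ^ (i : ℕ))] at hsum
  have hdet : ∑ σ : Equiv.Perm (Fin n), ((Equiv.Perm.sign σ : ℤ) : ℂ) *
      ((((d0 n t * hhA n t 0 : ℝ)) : ℂ) * E * ∏ i, z (σ i) ^ (i : ℕ)) =
      (((d0 n t * hhA n t 0 : ℝ)) : ℂ) * E * ∏ p ∈ prs n, (z p.2 - z p.1) := by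
    have h1 := Matrix.det_vandermonde z
    rw [← prod_pairs_Ioi n (fun i j => z j - z i), Matrix.det_apply'] at h1
    rw [← h1, Finset.mul_sum]
    refine Finset.sum_congr rfl fun σ _ => ?_
    simp only [Matrix.vandermonde_apply]
    ring
  rw [hdet] at hsum
  set V : ℂ := ∏ p ∈ prs n, (z p.2 - z p.1) with hV
  have hV0 : V ≠ 0 := by
    refine Finset.prod_ne_zero_iff.mpr fun p hp => ?_
    have hlt : p.1 < p.2 := by simpa using hp
    intro h
    have := hζ.pow_inj p.2.2 p.1.2 (sub_eq_zero.mp h)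
    exact hlt.ne (Fin.ext this.symm)
  have hth : ∏ p ∈ prs n, thP (q : ℂ) (z p.1 / z p.2) = V * E *
      (∏ p ∈ prs n, (qP ((q : ℂ) * (z p.1 / z p.2)) (q : ℂ) * qP ((q : ℂ) * (z p.2 / z p.1)) (q : ℂ)))
      * (qP (q : ℂ) (q : ℂ)) ^ (prs n).card := by
    rw [hE, ← prod_pairs_snd n (fun j => (z j)⁻¹), hV, ← Finset.prod_const]
    rw [← Finset.prod_mul_distrib, ← Finset.prod_mul_distrib, ← Finset.prod_mul_distrib]
    refine Finset.prod_congr rfl fun p _ => ?_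
    unfold thP
    rw [qP_first (z p.1 / z p.2) _ hqc, inv_div, mul_comm (z p.1 / z p.2) (q : ℂ)]
    have : (1 - z p.1 / z p.2) = (z p.2 - z p.1) * (z p.2)⁻¹ := by
      have := hz p.2
      field_simp
    rw [this]; ring
  rw [prod_pairs n (fun i j => qP ((q : ℂ) * (z i / z j)) (q : ℂ))] at hth
  have hall : (∏ i, ∏ j, if i = j then 1 else qP ((q : ℂ) * (z i / z j)) (q : ℂ)) *
      (qP (q : ℂ) (q : ℂ)) ^ n = (qP ((q : ℂ) ^ n) ((q : ℂ) ^ n)) ^ n := by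
    have h1 : (qP (q : ℂ) (q : ℂ)) ^ n = ∏ i : Fin n, ∏ j : Fin n,
        if i = j then qP (q : ℂ) (q : ℂ) else 1 := by simp
    rw [h1, ← Finset.prod_mul_distrib]
    simp only [← Finset.prod_mul_distrib]
    have h2 : ∀ i j : Fin n, ((if i = j then 1 else qP ((q : ℂ) * (z i / z j)) (q : ℂ)) *
        if i = j then qP (q : ℂ) (q : ℂ) else 1) = qP (ζ ^ (i : ℕ) * ((q : ℂ) / z j)) (q : ℂ) := by
      intro i j
      split_ifs with h
      · subst h
        rw [one_mul]; congr 1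
        have := hz i
        simp only [z] at this ⊢
        field_simp
      · rw [mul_one]; congr 1
        simp only [z]; ring
    simp only [h2]
    rw [Finset.prod_comm]
    have h3 : ∀ j : Fin n, ∏ i : Fin n, qP (ζ ^ (i : ℕ) * ((q : ℂ) / z j)) (q : ℂ)
        = qP ((q : ℂ) ^ n) ((q : ℂ) ^ n) := by
      intro j
      rw [qP_root hζ _ _ hqc, div_pow]
      simp only [z]; rw [← pow_mul, mul_comm (j : ℕ), pow_mul, hζ.pow_eq_one, one_pow, div_one]
    simp [h3]
  have hfin : ((d0 n t * hhA n t 0 * (qP q q) ^ n : ℝ) : ℂ) =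
      (((qP q q) ^ (prs n).card * (qP (q ^ n) (q ^ n)) ^ n : ℝ) : ℂ) := by
    push_cast
    rw [qP_ofReal _ _ hq1, qP_ofReal _ _ hqn]
    push_cast at hsum ⊢
    rw [← hall]
    apply mul_left_cancel₀ (mul_ne_zero hV0 hE0)
    have hsum' := hth.symm.trans hsum
    linear_combination (-(qP (q : ℂ) (q : ℂ)) ^ n) * hsum'
  exact_mod_cast hfin

lemma d0_eval (n : ℕ) [NeZero n] (t : ℝ) (ht : 0 < t) (q : ℝ) (hqd : q = Real.exp (-(2 * n * t))) :
    d0 n t = Real.exp (t * ∑ i : Fin n, ((i : ℕ) : ℝ) ^ 2) *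
      (qP q q) ^ ((n - 1) * (n - 2) / 2) := by
  have hn : (0 : ℝ) < n := by exact_mod_cast Nat.pos_of_ne_zero (NeZero.ne n)
  have hq1 : ‖q‖ < 1 := by
    rw [hqd, Real.norm_eq_abs, abs_of_pos (Real.exp_pos _), Real.exp_lt_one_iff]
    have := mul_pos hn ht; linarith
  have hqn : ‖q ^ n‖ < 1 := by rw [norm_pow]; exact pow_lt_one₀ (norm_nonneg _) hq1 (NeZero.ne n)
  have h1 := d0_aux n t ht q hqd
  have h2 := hh_eval n t ht
  rw [← hqd] at h2
  rw [card_prs] at h1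
  obtain ⟨k, hk⟩ : ∃ k, n = k + 1 := ⟨n - 1, by have := NeZero.ne n; omega⟩
  have hk' : n - 1 = k := by omega
  have hA := qPqq_ne_zero q hq1
  have hB := pow_ne_zero n (qPqq_ne_zero (q ^ n) hqn)
  set A := qP q q
  set B := qP (q ^ n) (q ^ n) ^ n
  set M := (n - 1) * (n - 2) / 2
  set S := ∑ i : Fin n, ((i : ℕ) : ℝ) ^ 2
  have hS : Real.exp (t * S) * Real.exp (-(t * S)) = 1 := by rw [← Real.exp_add]; simp
  have hAn : A ^ n = A * A ^ k := by rw [hk, pow_succ']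
  rw [hk', pow_add, hAn] at h1
  apply mul_right_cancel₀ (mul_ne_zero (mul_ne_zero hB (pow_ne_zero k hA)) (Real.exp_pos (-(t * S))).ne')
  linear_combination h1 - d0 n t * A ^ k * h2 - A ^ M * B * A ^ k * hS

end AuxD

section AuxMain
open Filter Topology

lemma ebar_sum (n : ℕ) (hn : 2 ≤ n) (μ : Fin n) : ∑ j, ebar n μ j = 0 := by
  have : (n : ℝ) ≠ 0 := by positivity
  simp [ebar, Finset.sum_sub_distrib, this]

lemma PLat_apply (n : ℕ) (c : Fin n → ℤ) (j : Fin n) :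
    (∑ μ, (c μ : ℝ) • ebar n μ) j = c j - (∑ μ, (c μ : ℝ)) / n := by
  simp [ebar, Finset.sum_apply, mul_sub, Finset.sum_sub_distrib, Finset.sum_mul, div_eq_mul_inv]

lemma PLat_sum (n : ℕ) (hn : 2 ≤ n) (v : Fin n → ℝ) (hv : v ∈ PLat n) : ∑ j, v j = 0 := by
  obtain ⟨c, rfl⟩ := hv
  have : (n : ℝ) ≠ 0 := by positivity
  simp only [PLat_apply, Finset.sum_sub_distrib]
  simp
  field_simp
  simp

lemma omegaw_sum (n m : ℕ) (hn : 2 ≤ n) : ∑ j, omegaw n m j = 0 := by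
  unfold omegaw
  simp only [Finset.sum_apply]
  rw [Finset.sum_comm]
  exact Finset.sum_eq_zero fun ν _ => ebar_sum n hn ν

lemma rhoWt_sum (n : ℕ) (hn : 2 ≤ n) : ∑ j, rhoWt n j = 0 := by
  unfold rhoWt
  simp only [Finset.sum_apply]
  rw [Finset.sum_comm]
  exact Finset.sum_eq_zero fun ν _ => omegaw_sum n ν hn

lemma omegaw_apply (n : ℕ) (i : Fin n) (j : Fin n) :
    omegaw n i.val j = (if j < i then 1 else 0) - (i : ℕ) / n := by
  unfold omegaw
  have hc : (Finset.univ.filter (fun ν : Fin n => (ν : ℕ) < (i : ℕ))).card = (i : ℕ) := by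
    have : Finset.univ.filter (fun ν : Fin n => (ν : ℕ) < (i : ℕ)) = Finset.Iio i := by
      ext ν; simp
    rw [this, Fin.card_Iio]
  simp only [Finset.sum_apply, ebar, Finset.sum_sub_distrib, Finset.sum_const, hc]
  simp [div_eq_mul_inv]

lemma sum_ind (n : ℕ) (i : Fin n) : ∑ j : Fin n, (if j < i then (1 : ℤ) else 0) = (i : ℕ) := by
  have hc : (Finset.univ.filter (fun ν : Fin n => ν < i)) = Finset.Iio i := by
    ext ν; simp
  rw [Finset.sum_boole, hc, Fin.card_Iio]

/-- parametrization of the summation range -/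
def idxEquiv (n : ℕ) (hn : 2 ≤ n) (ξ : Fin n → ℝ) (hξ : ξ ∈ PLat n) (i : Fin n) :
    ({b : Fin n → ℤ | ∑ j, b j = ((i : ℕ) : ℤ)} : Set (Fin n → ℤ)) ≃
      {p : Fin n → ℝ // p ∈ PLat n ∧ p - (ξ + omegaw n i.val) ∈ QLat n} :=
  Equiv.ofBijective (fun b => ⟨fun j => ξ j + ((b.1 j : ℝ) - (i : ℕ) / n), by
    have hb : ∑ j, (b.1 j : ℝ) = (i : ℕ) := by exact_mod_cast b.2
    constructor
    · obtain ⟨c, hc⟩ := hξ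
      refine ⟨fun j => c j + b.1 j, ?_⟩
      funext j
      rw [PLat_apply, hc, PLat_apply]
      push_cast
      rw [Finset.sum_add_distrib, hb]; ring
    · refine ⟨fun j => ⟨b.1 j - if j < i then 1 else 0, ?_⟩, ?_⟩
      · simp only [Pi.sub_apply, Pi.add_apply, omegaw_apply]
        push_cast; ring
      · simp only [Pi.sub_apply, Pi.add_apply, Finset.sum_sub_distrib, Finset.sum_add_distrib,
          omegaw_sum n _ hn, hb]
        have : (n : ℝ) ≠ 0 := by positivity
        simp
        field_simp
        simp⟩) (by
    constructor
    · intro b b' h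
      apply Subtype.ext
      funext j
      have := congrFun (congrArg Subtype.val h) j
      simp only [add_right_inj, sub_left_inj] at this
      exact_mod_cast this
    · rintro ⟨p, hp, hq⟩
      choose m hm using hq.1
      have hms : ∑ j, m j = 0 := by
        have := hq.2
        simp only [hm] at this
        exact_mod_cast this
      refine ⟨⟨fun j => m j + if j < i then 1 else 0, ?_⟩, ?_⟩
      · simp only [Set.mem_ofPred_eq, Finset.sum_add_distrib, hms, sum_ind, zero_add]
      · apply Subtype.ext
        funext j
        have := hm j
        simp only [Pi.sub_apply, Pi.add_apply, omegaw_apply] at this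
        simp only
        push_cast
        linear_combination -this)

lemma idxEquiv_apply (n : ℕ) (hn : 2 ≤ n) (ξ : Fin n → ℝ) (hξ : ξ ∈ PLat n) (i : Fin n)
    (b : ({b : Fin n → ℤ | ∑ j, b j = ((i : ℕ) : ℤ)} : Set (Fin n → ℤ))) (j : Fin n) :
    (idxEquiv n hn ξ hξ i b).1 j = ξ j + ((b.1 j : ℝ) - (i : ℕ) / n) := rfl

/-- coefficient -/
def coD (n : ℕ) (t : ℝ) (rb : (Fin n → Fin n) × (Fin n → ℤ)) : ℝ :=
  if ∑ i, rb.2 i = 0 then sgMap rb.1 * d0 n t else 0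

/-- exponent vector -/
def mmR (n : ℕ) (rb : (Fin n → Fin n) × (Fin n → ℤ)) (i : Fin n) : ℝ :=
  ((rb.1 i : ℕ) : ℝ) + n * rb.2 i

lemma sum_pairs_sq (n : ℕ) (A : Fin n → ℝ) (hA : ∑ j, A j = 0) :
    ∑ p ∈ prs n, (A p.1 - A p.2) ^ 2 = n * ∑ j, A j ^ 2 := by
  have h := sum_pairs n (fun i j => (A i - A j) ^ 2 / 2)
  have h1 : ∑ p ∈ prs n, (A p.1 - A p.2) ^ 2 =
      ∑ p ∈ prs n, ((A p.1 - A p.2) ^ 2 / 2 + (A p.2 - A p.1) ^ 2 / 2) :=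
    Finset.sum_congr rfl fun p _ => by ring
  rw [h1, h]
  have h2 : ∀ i j, (if i = j then 0 else (A i - A j) ^ 2 / 2) =
      (A i ^ 2 / 2 + A j ^ 2 / 2) - A i * A j := by
    intro i j
    split_ifs with hij
    · subst hij; ring
    · ring
  simp only [h2, Finset.sum_sub_distrib, Finset.sum_add_distrib, ← Finset.mul_sum, hA]
  simp only [Finset.sum_const, Finset.card_univ, Fintype.card_fin, nsmul_eq_mul, mul_zero,
    ← Finset.mul_sum, ← Finset.sum_div]
  ring

lemma sum_pairs_lin (n : ℕ) (A : Fin n → ℝ) (hA : ∑ j, A j = 0) :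
    ∑ p ∈ prs n, (A p.1 - A p.2) = - 2 * ∑ j : Fin n, ((j : ℕ) : ℝ) * A j := by
  have h := sum_pairs n (fun i _ => A i)
  have h1 : ∑ p ∈ prs n, (A p.1 - A p.2) =
      ∑ p ∈ prs n, (A p.1 + A p.2) - 2 * ∑ p ∈ prs n, A p.2 := by
    rw [Finset.mul_sum, ← Finset.sum_sub_distrib]
    exact Finset.sum_congr rfl fun p _ => by ring
  have h2 : ∀ i j : Fin n, (if i = j then 0 else A i) = A i - if i = j then A i else 0 := by
    intro i j; split_ifs <;> ring
  have h3 := sum_pairs_snd n A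
  rw [h1, h, h3]
  simp only [h2, Finset.sum_sub_distrib]
  simp [← Finset.mul_sum, hA]

lemma brk_hasSum (n : ℕ) [NeZero n] (ε x s : ℝ) (hε : 0 < ε) (hx : x = Real.exp (-ε)) (hs : 0 < s)
    (A : Fin n → ℝ) (hA : ∑ j, A j = 0) :
    HasSum (fun rb : (Fin n → Fin n) × (Fin n → ℤ) => coD n (s * ε / n) rb *
      Real.exp (-(ε * ∑ j, (n * A j ^ 2 / s + 2 * (A j * mmR n rb j) + s / n * mmR n rb j ^ 2))))
      (∏ p ∈ prs n, (x ^ ((A p.1 - A p.2) ^ 2 / s - (A p.1 - A p.2)) *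
        thetaR (x ^ (2 * s)) (x ^ (2 * (A p.1 - A p.2))))) := by
  have hn : (0 : ℝ) < n := by exact_mod_cast Nat.pos_of_ne_zero (NeZero.ne n)
  have hm := macd2 (𝕜 := ℝ) (n := n) (s * ε / n) (by positivity)
    (fun j => Real.exp (-(2 * ε * A j))) (fun j => (Real.exp_pos _).ne')
  have hpow : ∀ y : ℝ, x ^ y = Real.exp (-(ε * y)) := by
    intro y; rw [hx, ← Real.exp_mul]; congr 1; ring
  have hval : ∏ p ∈ prs n, (x ^ ((A p.1 - A p.2) ^ 2 / s - (A p.1 - A p.2)) *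
        thetaR (x ^ (2 * s)) (x ^ (2 * (A p.1 - A p.2)))) =
      Real.exp (-(ε * (∑ j, n * A j ^ 2 / s + 2 * ∑ j : Fin n, ((j : ℕ) : ℝ) * A j))) *
      ∏ p ∈ prs n, thP (Real.exp (-(2 * n * (s * ε / n))))
        (Real.exp (-(2 * ε * A p.1)) / Real.exp (-(2 * ε * A p.2))) := by
    rw [Finset.prod_mul_distrib]
    congr 1
    · simp only [hpow]
      rw [← Real.exp_sum, Finset.sum_neg_distrib, ← Finset.mul_sum, Finset.sum_sub_distrib,
        sum_pairs_lin n A hA, ← Finset.sum_div, sum_pairs_sq n A hA, ← Finset.sum_div,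
        ← Finset.mul_sum]
      congr 2; ring
    · refine Finset.prod_congr rfl fun p _ => ?_
      have e1 : x ^ (2 * s) = Real.exp (-(2 * n * (s * ε / n))) := by
        rw [hpow]; congr 1; field_simp
      have e2 : x ^ (2 * (A p.1 - A p.2))
          = Real.exp (-(2 * ε * A p.1)) / Real.exp (-(2 * ε * A p.2)) := by
        rw [hpow, ← Real.exp_sub]; congr 1; ring
      rw [e1, e2]; rfl
  rw [hval]
  have h2 := hm.mul_left
    (Real.exp (-(ε * (∑ j, n * A j ^ 2 / s + 2 * ∑ j : Fin n, ((j : ℕ) : ℝ) * A j))))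
  refine h2.congr_fun fun rb => ?_
  have h3 : ∏ i : Fin n, Real.exp (-(2 * ε * A i)) ^ ((((rb.1 i : ℕ) : ℤ) + n * rb.2 i) - (i : ℕ))
      = Real.exp (∑ i : Fin n, (-(2 * ε * A i)) * (mmR n rb i - (i : ℕ))) := by
    rw [Real.exp_sum]
    refine Finset.prod_congr rfl fun i _ => ?_
    rw [exp_zpow]; unfold mmR; push_cast; rfl
  rw [h3]
  have h4 : ((((if ∑ i, rb.2 i = 0 then sgMap rb.1 * d0 n (s * ε / n) else 0) *
        Real.exp (-(s * ε / n * ∑ i, (((rb.1 i : ℕ) : ℝ) + n * rb.2 i) ^ 2)) : ℝ)) : ℝ) =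
        coD n (s * ε / n) rb * Real.exp (-(s * ε / n * ∑ i, (mmR n rb i) ^ 2)) := rfl
  have h5 : Real.exp (-(ε * ∑ j, (n * A j ^ 2 / s + 2 * (A j * mmR n rb j) + s / n * mmR n rb j ^ 2)))
      = Real.exp (-(ε * (∑ j, n * A j ^ 2 / s + 2 * ∑ j : Fin n, ((j : ℕ) : ℝ) * A j))) *
        (Real.exp (-(s * ε / n * ∑ i, (mmR n rb i) ^ 2)) *
        Real.exp (∑ i : Fin n, (-(2 * ε * A i)) * (mmR n rb i - (i : ℕ)))) := by
    rw [← Real.exp_add, ← Real.exp_add]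
    congr 1
    simp only [Finset.mul_sum, ← Finset.sum_neg_distrib, ← Finset.sum_add_distrib]
    refine Finset.sum_congr rfl fun i _ => ?_
    ring
  have h4' := h4
  simp only [RCLike.ofReal_real_eq_id, id_eq] at h4' ⊢
  rw [h4', h5]
  ring

lemma swap_hasSum {α β : Type*} (U : α → ℝ) (W : α → β → ℝ) (R H C c : ℝ) (hU : HasSum U R)
    (hW0 : ∀ a b, 0 ≤ W a b) (hWs : ∀ a, Summable (W a)) (hWC : ∀ a, ∑' b, W a b ≤ C)
    (hH : ∀ a, U a ≠ 0 → HasSum (W a) H) (T : β → ℝ)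
    (hT : ∀ b, HasSum (fun a => c * U a * W a b) (T b)) : HasSum T (c * R * H) := by
  let F : α × β → ℝ := fun p => c * U p.1 * W p.1 p.2
  have hF : Summable F := by
    rw [← summable_norm_iff]
    rw [summable_prod_of_nonneg (fun p => norm_nonneg _)]
    have e : ∀ a b, ‖F (a, b)‖ = ‖c * U a‖ * W a b := by
      intro a b
      simp only [F]
      rw [norm_mul, Real.norm_of_nonneg (hW0 a b)]
    simp only [e, tsum_mul_left]
    refine ⟨fun a => (hWs a).mul_left _, ?_⟩
    refine Summable.of_nonneg_of_le (fun a => mul_nonneg (norm_nonneg _)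
      (tsum_nonneg fun b => hW0 a b)) (fun a => mul_le_mul_of_nonneg_left (hWC a) (norm_nonneg _)) ?_
    exact ((hU.summable.mul_left c).norm).mul_right C
  have h1 : HasSum (fun a => c * U a * H) (∑' p, F p) := by
    refine hF.hasSum.prod_fiberwise fun a => ?_
    by_cases h : U a = 0
    · simp only [F, h, mul_zero, zero_mul]; exact hasSum_zero
    · exact (hH a h).mul_left _
  have h2 := h1.unique ((hU.mul_left c).mul_right H)
  have h3 : HasSum (F ∘ (Equiv.prodComm β α)) (∑' p, F p) :=
    (Equiv.prodComm β α).hasSum_iff.mpr hF.hasSum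
  rw [h2] at h3
  exact h3.prod_fiberwise hT

end AuxMain

/-- Lattice theta sum formula: with `l = ξ + ρ`, `β₁ = -√((r-1)/r)`, `β₂ = √(r/(r-1))`
(the roots of `t² - β₀ t - 1 = 0`, `β₀ = 1/√(r(r-1))`), the sum of
`x^{n⟨β₁(a+ρ)+β₂l, β₁(a+ρ)+β₂l⟩} ∏_{μ<ν} [a_{μν}]` over `a ∈ P`, `a ≡ ξ+ω_i (mod Q)`,
converges (absolutely, as a real series) to
`(x^{2n};x^{2n})_∞^{n-1} ((x^{2n};x^{2n})_∞/(x²;x²)_∞)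
 ((x^{2r};x^{2r})_∞/(x^{2r-2};x^{2r-2})_∞)^{(n-1)(n-2)/2} ∏_{μ<ν} [ξ_{μν}]'`. -/
theorem lattice_theta_sum (n : ℕ) (hn : 2 ≤ n) (ε x r : ℝ) (hε : 0 < ε)
    (hx : x = Real.exp (-ε)) (hr : (n : ℝ) - 1 < r)
    (ξ : Fin n → ℝ) (hξ : ξ ∈ PLat n)
    (hreg : ∀ μ ν : Fin n, μ ≠ ν → ebrkR' x r (abar n ξ μ - abar n ξ ν) ≠ 0)
    (i : Fin n) :
    HasSum
      (fun a : {p : Fin n → ℝ // p ∈ PLat n ∧ p - (ξ + omegaw n i.val) ∈ QLat n} =>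
        x ^ ((n : ℝ) * ∑ j,
            (-Real.sqrt ((r - 1) / r) * (a.1 j + rhoWt n j) +
              Real.sqrt (r / (r - 1)) * (ξ j + rhoWt n j)) ^ 2) *
          ∏ p ∈ Finset.univ.filter (fun p : Fin n × Fin n => p.1 < p.2),
            ebrkR x r (abar n a.1 p.1 - abar n a.1 p.2))
      (qPochR (x ^ (2 * n)) (x ^ (2 * n)) ^ (n - 1) *
        (qPochR (x ^ (2 * n)) (x ^ (2 * n)) / qPochR (x ^ 2) (x ^ 2)) *
        (qPochR (x ^ (2 * r)) (x ^ (2 * r)) / qPochR (x ^ (2 * r - 2)) (x ^ (2 * r - 2))) ^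
          ((n - 1) * (n - 2) / 2) *
        ∏ p ∈ Finset.univ.filter (fun p : Fin n × Fin n => p.1 < p.2),
          ebrkR' x r (abar n ξ p.1 - abar n ξ p.2)) := by
  have hnz : NeZero n := ⟨by omega⟩
  have hn2 : (2 : ℝ) ≤ n := by exact_mod_cast hn
  have hnpos : (0 : ℝ) < n := by linarith
  have hr1 : 0 < r - 1 := by linarith
  have hr0 : 0 < r := by linarith
  have hpow : ∀ y : ℝ, x ^ y = Real.exp (-(ε * y)) := by
    intro y; rw [hx, ← Real.exp_mul]; congr 1; ring
  set l : Fin n → ℝ := fun j => ξ j + rhoWt n j with hl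
  have hlsum : ∑ j, l j = 0 := by
    simp only [hl, Finset.sum_add_distrib, rhoWt_sum n hn, PLat_sum n hn ξ hξ, add_zero]
  have hUsum := brk_hasSum n ε x (r - 1) hε hx hr1 l hlsum
  have hR : ∏ p ∈ prs n, (x ^ ((l p.1 - l p.2) ^ 2 / (r - 1) - (l p.1 - l p.2)) *
        thetaR (x ^ (2 * (r - 1))) (x ^ (2 * (l p.1 - l p.2)))) =
      ∏ p ∈ Finset.univ.filter (fun p : Fin n × Fin n => p.1 < p.2),
          ebrkR' x r (abar n ξ p.1 - abar n ξ p.2) := by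
    refine Finset.prod_congr rfl fun p _ => ?_
    unfold ebrkR'
    rw [show 2 * r - 2 = 2 * (r - 1) by ring]; rfl
  rw [hR] at hUsum
  have htr : 0 < r * ε / n := by positivity
  have htr' : 0 < (r - 1) * ε / n := by positivity
  have hth : 0 < ε / n := by positivity
  have hqr : x ^ (2 * r) = Real.exp (-(2 * n * (r * ε / n))) := by
    rw [hpow]; congr 1; field_simp
  have hqr' : x ^ (2 * r - 2) = Real.exp (-(2 * n * ((r - 1) * ε / n))) := by
    rw [hpow]; congr 1; field_simp
  have hq2 : x ^ 2 = Real.exp (-(2 * n * (ε / n))) := by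
    rw [hx, ← Real.exp_nat_mul]; congr 1; push_cast; field_simp
  have hd := d0_eval n _ htr _ hqr
  have hd' := d0_eval n _ htr' _ hqr'
  have hh := hh_eval n _ hth
  rw [← hq2, ← pow_mul] at hh
  have hlt : ∀ y : ℝ, 0 < y → ‖Real.exp (-(2 * n * y))‖ < 1 := by
    intro y hy
    rw [Real.norm_eq_abs, abs_of_pos (Real.exp_pos _), Real.exp_lt_one_iff]
    have := mul_pos hnpos hy; linarith
  have hA' : qP (x ^ (2 * r - 2)) (x ^ (2 * r - 2)) ≠ 0 := by
    rw [hqr']; exact qPqq_ne_zero _ (hlt _ htr')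
  have hA2 : qP (x ^ 2) (x ^ 2) ≠ 0 := by
    rw [hq2]; exact qPqq_ne_zero _ (hlt _ hth)
  have hd'0 : d0 n ((r - 1) * ε / n) ≠ 0 := by
    rw [hd']; exact mul_ne_zero (Real.exp_pos _).ne' (pow_ne_zero _ hA')
  set c : ℝ := d0 n (r * ε / n) / d0 n ((r - 1) * ε / n) with hc
  have hcD : ∀ rb, coD n (r * ε / n) rb = c * coD n ((r - 1) * ε / n) rb := by
    intro rb
    unfold coD
    split_ifs
    · rw [hc, mul_left_comm, div_mul_cancel₀ _ hd'0]
    · simp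
  let W : (Fin n → Fin n) × (Fin n → ℤ) → (Fin n → ℤ) → ℝ := fun rb b =>
    if ∑ j, b j = ((i : ℕ) : ℤ) then
      Real.exp (-(ε / n * ∑ j, (((rb.1 j : ℕ) : ℝ) + n * rb.2 j + n * b j - ((i : ℕ) : ℤ)) ^ 2))
    else 0
  have hW0 : ∀ rb b, 0 ≤ W rb b := by
    intro rb b; simp only [W]; split_ifs
    · positivity
    · rfl
  obtain ⟨C, hC⟩ := gaussN (ε / n) hth n
  have hWle : ∀ rb b, W rb b ≤ Real.exp (-(ε / n * ∑ j,
      ((((rb.1 j : ℕ) : ℝ) + n * rb.2 j - ((i : ℕ) : ℤ)) + n * b j) ^ 2)) := by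
    intro rb b; simp only [W]; split_ifs
    · apply le_of_eq; congr 3
      refine Finset.sum_congr rfl fun j _ => ?_
      ring
    · positivity
  have hWs : ∀ rb, Summable (W rb) := fun rb =>
    Summable.of_nonneg_of_le (hW0 rb) (hWle rb) (hC _).1
  have hWC : ∀ rb, ∑' b, W rb b ≤ C := fun rb =>
    ((hWs rb).tsum_le_tsum (hWle rb) (hC _).1).trans (hC _).2
  let term : (Fin n → ℝ) → ℝ := fun a =>
    x ^ ((n : ℝ) * ∑ j,
            (-Real.sqrt ((r - 1) / r) * (a j + rhoWt n j) +
              Real.sqrt (r / (r - 1)) * (ξ j + rhoWt n j)) ^ 2) *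
          ∏ p ∈ Finset.univ.filter (fun p : Fin n × Fin n => p.1 < p.2),
            ebrkR x r (abar n a p.1 - abar n a p.2)
  let S : Set (Fin n → ℤ) := {b : Fin n → ℤ | ∑ j, b j = ((i : ℕ) : ℤ)}
  have hmemS : ∀ b, b ∈ S ↔ ∑ j, b j = ((i : ℕ) : ℤ) := fun b => Iff.rfl
  let T : (Fin n → ℤ) → ℝ := fun b => term (fun j => ξ j + ((b j : ℝ) - (i : ℕ) / n))
  have hmain := swap_hasSum _ W _ (hhA n (ε / n) 0) C c hUsum hW0 hWs hWC (by
    intro rb hU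
    have hco : coD n ((r - 1) * ε / n) rb ≠ 0 := left_ne_zero_of_mul hU
    have hb : ∑ j, rb.2 j = 0 := by
      by_contra h
      exact hco (by unfold coD; rw [if_neg h])
    have hbij : Function.Bijective rb.1 := by
      by_contra h
      apply hco
      unfold coD sgMap
      rw [if_pos hb, dif_neg h, zero_mul]
    exact hh_perm n (ε / n) hth (Equiv.ofBijective rb.1 hbij) rb.2 hb ((i : ℕ) : ℤ))
    (S.indicator T) (by
    intro b
    by_cases hb : ∑ j, b j = ((i : ℕ) : ℤ)
    · rw [Set.indicator_of_mem ((hmemS b).mpr hb)]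
      set A : Fin n → ℝ := fun j => l j + ((b j : ℝ) - (i : ℕ) / n) with hAdef
      have hbr : ∑ j, (b j : ℝ) = (i : ℕ) := by exact_mod_cast hb
      have hAsum : ∑ j, A j = 0 := by
        simp only [hAdef, Finset.sum_add_distrib, Finset.sum_sub_distrib, hlsum, hbr]
        simp
        field_simp
        simp
      have hbk := (brk_hasSum n ε x r hε hx hr0 A hAsum).mul_left
        (x ^ ((n : ℝ) * ∑ j, (-Real.sqrt ((r - 1) / r) * A j + Real.sqrt (r / (r - 1)) * l j) ^ 2))
      have hTval : T b = x ^ ((n : ℝ) * ∑ j, (-Real.sqrt ((r - 1) / r) * A j +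
          Real.sqrt (r / (r - 1)) * l j) ^ 2) *
          ∏ p ∈ prs n, (x ^ ((A p.1 - A p.2) ^ 2 / r - (A p.1 - A p.2)) *
            thetaR (x ^ (2 * r)) (x ^ (2 * (A p.1 - A p.2)))) := by
        have hAj : ∀ j, ξ j + ((b j : ℝ) - (i : ℕ) / n) + rhoWt n j = A j := by
          intro j; simp only [hAdef, hl]; ring
        simp only [T, term, ebrkR, abar, hAj]
        rfl
      rw [hTval]
      refine hbk.congr_fun fun rb => ?_
      rw [hcD]
      simp only [W, if_pos hb]
      have hexp : x ^ ((n : ℝ) * ∑ j, (-Real.sqrt ((r - 1) / r) * A j +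
          Real.sqrt (r / (r - 1)) * l j) ^ 2) *
          Real.exp (-(ε * ∑ j, (n * A j ^ 2 / r + 2 * (A j * mmR n rb j) + r / n * mmR n rb j ^ 2)))
          = Real.exp (-(ε * ∑ j, (n * l j ^ 2 / (r - 1) + 2 * (l j * mmR n rb j) +
              (r - 1) / n * mmR n rb j ^ 2))) *
            Real.exp (-(ε / n * ∑ j, (((rb.1 j : ℕ) : ℝ) + n * rb.2 j + n * b j -
              ((i : ℕ) : ℤ)) ^ 2)) := by
        rw [hpow, ← Real.exp_add, ← Real.exp_add]
        congr 1
        simp only [Finset.mul_sum, ← Finset.sum_neg_distrib, ← Finset.sum_add_distrib]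
        refine Finset.sum_congr rfl fun j _ => ?_
        have s1 : Real.sqrt ((r - 1) / r) ^ 2 = (r - 1) / r := Real.sq_sqrt (by positivity)
        have s2 : Real.sqrt (r / (r - 1)) ^ 2 = r / (r - 1) := Real.sq_sqrt (by positivity)
        have s3 : Real.sqrt ((r - 1) / r) * Real.sqrt (r / (r - 1)) = 1 := by
          rw [← Real.sqrt_mul (by positivity)]
          have : (r - 1) / r * (r / (r - 1)) = 1 := by field_simp
          rw [this, Real.sqrt_one]
        have s4 : (-Real.sqrt ((r - 1) / r) * A j + Real.sqrt (r / (r - 1)) * l j) ^ 2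
            = (r - 1) / r * A j ^ 2 + r / (r - 1) * l j ^ 2 - 2 * (A j * l j) := by
          linear_combination A j ^ 2 * s1 + l j ^ 2 * s2 - 2 * A j * l j * s3
        rw [s4]
        have s5 : ((rb.1 j : ℕ) : ℝ) + n * rb.2 j = mmR n rb j := rfl
        have s6 : A j = l j + ((b j : ℝ) - (i : ℕ) / n) := rfl
        rw [s5, s6]
        push_cast
        have := hr1.ne'
        field_simp
        ring
      linear_combination (-(c * coD n ((r - 1) * ε / n) rb)) * hexp
    · rw [Set.indicator_of_notMem (fun h => hb ((hmemS b).mp h))]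
      simp only [W, if_neg hb, mul_zero]
      exact hasSum_zero)
  have hval : c * (∏ p ∈ Finset.univ.filter (fun p : Fin n × Fin n => p.1 < p.2),
          ebrkR' x r (abar n ξ p.1 - abar n ξ p.2)) * hhA n (ε / n) 0 =
      (qPochR (x ^ (2 * n)) (x ^ (2 * n)) ^ (n - 1) *
        (qPochR (x ^ (2 * n)) (x ^ (2 * n)) / qPochR (x ^ 2) (x ^ 2)) *
        (qPochR (x ^ (2 * r)) (x ^ (2 * r)) / qPochR (x ^ (2 * r - 2)) (x ^ (2 * r - 2))) ^
          ((n - 1) * (n - 2) / 2) *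
        ∏ p ∈ Finset.univ.filter (fun p : Fin n × Fin n => p.1 < p.2),
          ebrkR' x r (abar n ξ p.1 - abar n ξ p.2)) := by
    have hqq : ∀ z q : ℝ, qPochR z q = qP z q := fun z q => rfl
    simp only [hqq]
    have hHv : hhA n (ε / n) 0 = Real.exp (-(ε / n * ∑ i : Fin n, ((i : ℕ) : ℝ) ^ 2)) *
        qP (x ^ (2 * n)) (x ^ (2 * n)) ^ n / qP (x ^ 2) (x ^ 2) := by
      rw [eq_div_iff hA2, hh]
    have hnn : qP (x ^ (2 * n)) (x ^ (2 * n)) ^ n =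
        qP (x ^ (2 * n)) (x ^ (2 * n)) ^ (n - 1) * qP (x ^ (2 * n)) (x ^ (2 * n)) := by
      rw [← pow_succ]; congr 1; omega
    have hE : Real.exp (r * ε / n * ∑ i : Fin n, ((i : ℕ) : ℝ) ^ 2) =
        Real.exp ((r - 1) * ε / n * ∑ i : Fin n, ((i : ℕ) : ℝ) ^ 2) *
        Real.exp (ε / n * ∑ i : Fin n, ((i : ℕ) : ℝ) ^ 2) := by
      rw [← Real.exp_add]; congr 1; ring
    rw [hc, hd, hd', hHv, hnn, hE, Real.exp_neg, div_pow]
    have h1 := (Real.exp_pos ((r - 1) * ε / n * ∑ i : Fin n, ((i : ℕ) : ℝ) ^ 2)).ne'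
    have h2 := (Real.exp_pos (ε / n * ∑ i : Fin n, ((i : ℕ) : ℝ) ^ 2)).ne'
    have h3 := pow_ne_zero ((n - 1) * (n - 2) / 2) hA'
    generalize Real.exp ((r - 1) * ε / n * ∑ i : Fin n, ((i : ℕ) : ℝ) ^ 2) = X1 at *
    generalize Real.exp (ε / n * ∑ i : Fin n, ((i : ℕ) : ℝ) ^ 2) = X2 at *
    generalize qP (x ^ (2 * r - 2)) (x ^ (2 * r - 2)) ^ ((n - 1) * (n - 2) / 2) = X3 at *
    generalize qP (x ^ 2) (x ^ 2) = X4 at *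
    generalize qP (x ^ (2 * n)) (x ^ (2 * n)) ^ (n - 1) = X5 at *
    field_simp
  rw [hval] at hmain
  rw [← hasSum_subtype_iff_indicator] at hmain
  rw [← (idxEquiv n hn ξ hξ i).hasSum_iff]
  exact hmain

end
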